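/- arXiv:math/0011094 — 6 statements merged into one kernel-verified Lean document; each statement's English description precedes it below -/
import Mathlib

section
/- Let (A, 𝔪, k) be a commutative local ring with residue field k = A/𝔪, and let k ⊆ L be a finite field extension. Then there exists a commutative ring B containing A such that: (i) B is a free A-module of rank N = [L : k]; and (ii) B is a local ring with maximal ideal 𝔪·B, and B/𝔪B is isomorphic to L as a field extension of k. -/
open Polynomial IntermediateField in
/-- A ring homomorphism onto a field `K` extends to a monogenic finite free extension, with image
a given simple algebraic extension of `K` and kernel the extended ideal. -/
theorem exists_monic_lift_adjoinRoot_simple {B K L : Type*} [CommRing B] [Field K] [Field L]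
    [Algebra K L] (f : B →+* K) (hf : Function.Surjective f) {x : L} (hx : IsIntegral K x) :
    ∃ (g : B[X]) (φ : AdjoinRoot g →+* L), g.Monic ∧
      φ.comp (AdjoinRoot.of g) = (algebraMap K L).comp f ∧
      Set.range φ = K⟮x⟯ ∧
      RingHom.ker φ = (RingHom.ker f).map (AdjoinRoot.of g) := by
  obtain ⟨g, hg, -, hgm⟩ := lifts_and_natDegree_eq_and_monic
    ((mem_lifts _).2 (map_surjective f hf (minpoly K x))) (minpoly.monic hx)
  have heval (p : B[X]) : p.eval₂ ((algebraMap K L).comp f) x = aeval x (p.map f) := by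
    rw [aeval_def, eval₂_map]
  have hroot : g.eval₂ ((algebraMap K L).comp f) x = 0 := by
    rw [heval, hg, minpoly.aeval]
  have hlift (p : B[X]) :
      AdjoinRoot.lift ((algebraMap K L).comp f) x hroot (AdjoinRoot.mk g p) =
        aeval x (p.map f) := by
    rw [AdjoinRoot.lift_mk, heval]
  refine ⟨g, AdjoinRoot.lift _ x hroot, hgm, AdjoinRoot.lift_comp_of _, ?_, le_antisymm ?_ ?_⟩
  · have hrange : (K⟮x⟯ : Set L) = Set.range (aeval (R := K) x) := by
      rw [← AlgHom.coe_range, ← Algebra.adjoin_singleton_eq_range_aeval,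
        ← adjoin_simple_toSubalgebra_of_isAlgebraic hx.isAlgebraic]
      rfl
    rw [hrange, ← AdjoinRoot.mk_surjective.range_comp, ← (map_surjective f hf).range_comp]
    exact congrArg Set.range (funext hlift)
  · intro y hy
    obtain ⟨p, rfl⟩ := AdjoinRoot.mk_surjective y
    rw [RingHom.mem_ker, hlift] at hy
    obtain ⟨q, hq⟩ := minpoly.dvd K x hy
    obtain ⟨q, rfl⟩ := map_surjective f hf q
    have hmem : p - g * q ∈ RingHom.ker (mapRingHom f) := by
      simp [RingHom.mem_ker, hg, hq]
    rw [ker_mapRingHom] at hmem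
    have := Ideal.mem_map_of_mem (AdjoinRoot.mk g) hmem
    rw [Ideal.map_map] at this
    simpa [AdjoinRoot.of] using this
  · rw [Ideal.map_le_iff_le_comap]
    intro b hb
    rw [RingHom.mem_ker] at hb
    simp [RingHom.mem_ker, hb]

namespace IsLocalRing

open IntermediateField in
/-- Every finite extension of the residue field of a local ring `A` is a quotient of a finite
free `A`-algebra by the extension of the maximal ideal. -/
theorem exists_finite_free_lift_intermediateField {A L : Type} [CommRing A] [IsLocalRing A]
    [Field L] [Algebra (ResidueField A) L] [FiniteDimensional (ResidueField A) L]
    [Algebra A L] [IsScalarTower A (ResidueField A) L] (K : IntermediateField (ResidueField A) L) :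
    ∃ (B : Type) (_ : CommRing B) (_ : Algebra A B) (f : B →ₐ[A] L),
      Module.Free A B ∧ Module.Finite A B ∧ Set.range f = K ∧
      RingHom.ker f = (maximalIdeal A).map (algebraMap A B) := by
  induction K using induction_on_adjoin with
  | base =>
    refine ⟨A, inferInstance, inferInstance, Algebra.ofId A L, inferInstance, inferInstance, ?_, ?_⟩
    · ext y
      simp only [Set.mem_range, SetLike.mem_coe, mem_bot, Algebra.ofId_apply,
        IsScalarTower.algebraMap_apply A (ResidueField A) L]
      exact ((residue_surjective (R := A)).exists
        (p := fun z => algebraMap (ResidueField A) L z = y)).symm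
    · ext a
      simp [RingHom.mem_ker, Algebra.ofId_apply,
        IsScalarTower.algebraMap_apply A (ResidueField A) L]
  | ih K x ih =>
    obtain ⟨B, _, _, f, _, _, hfK, hker⟩ := ih
    have hmem (b : B) : f b ∈ K := by
      rw [← SetLike.mem_coe, ← hfK]
      exact Set.mem_range_self b
    let f₀ : B →+* K := f.toRingHom.codRestrict K hmem
    have hf₀ : Function.Surjective f₀ := by
      rintro ⟨y, hy⟩
      rw [← SetLike.mem_coe, ← hfK] at hy
      obtain ⟨b, rfl⟩ := hy
      exact ⟨b, rfl⟩
    have hker₀ : RingHom.ker f₀ = RingHom.ker f := by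
      ext b
      exact Subtype.ext_iff
    obtain ⟨g, φ, hg, hφ, hrange, hφker⟩ :=
      exists_monic_lift_adjoinRoot_simple f₀ hf₀ (Algebra.IsIntegral.isIntegral (R := K) x)
    have := hg.free_adjoinRoot
    have := hg.finite_adjoinRoot
    refine ⟨AdjoinRoot g, inferInstance, inferInstance,
      { φ with commutes' := fun a => ?_ }, Module.Free.trans (S := B),
      Module.Finite.trans B _, hrange, ?_⟩
    · rw [IsScalarTower.algebraMap_apply A B (AdjoinRoot g)]
      exact (RingHom.congr_fun hφ _).trans (f.commutes a)
    · refine Eq.trans hφker ?_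
      rw [hker₀, hker, Ideal.map_map, IsScalarTower.algebraMap_eq A B (AdjoinRoot g)]
      rfl

/-- An integral algebra over a local ring in which the extension of the maximal ideal is maximal
has no other maximal ideal. -/
theorem eq_map_maximalIdeal_of_isMaximal {A B : Type*} [CommRing A] [IsLocalRing A] [CommRing B]
    [Algebra A B] [Algebra.IsIntegral A B]
    (h : ((maximalIdeal A).map (algebraMap A B)).IsMaximal) (M : Ideal B) [hM : M.IsMaximal] :
    M = (maximalIdeal A).map (algebraMap A B) := by
  refine (h.eq_of_le hM.ne_top ?_).symm
  rw [Ideal.map_le_iff_le_comap]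
  exact (eq_maximalIdeal (Ideal.isMaximal_comap_of_isIntegral_of_isMaximal M)).ge

end IsLocalRing


/-- Let `(A, 𝔪, k)` be a commutative local ring with residue field `k`
and `k ⊆ L` a finite field extension.  Then there exists an extension ring `A ⊆ B` such
that (i) `B` is a free `A`-module of rank `N = [L : k]`, and (ii) `B` is local with maximal
ideal `𝔪·B` and `B/𝔪B ≅ L` (as a field extension of `k`, i.e. compatibly with the
`A`-algebra structures). -/
theorem exists_local_extension_with_residue_extension (A : Type) [CommRing A]
    [IsLocalRing A] (L : Type) [Field L]
    [Algebra (IsLocalRing.ResidueField A) L]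
    [FiniteDimensional (IsLocalRing.ResidueField A) L]
    [Algebra A L] [IsScalarTower A (IsLocalRing.ResidueField A) L] :
    ∃ (B : Type) (_ : CommRing B) (_ : Algebra A B) (_ : IsLocalRing B),
      Function.Injective (algebraMap A B) ∧
      Module.Free A B ∧
      Module.finrank A B = Module.finrank (IsLocalRing.ResidueField A) L ∧
      IsLocalRing.maximalIdeal B =
        Ideal.map (algebraMap A B) (IsLocalRing.maximalIdeal A) ∧
      Nonempty ((B ⧸ Ideal.map (algebraMap A B) (IsLocalRing.maximalIdeal A)) ≃ₐ[A] L) := by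
  obtain ⟨B, _, _, f, _, _, hrange, hker⟩ :=
    IsLocalRing.exists_finite_free_lift_intermediateField (A := A) (L := L) ⊤
  have hsurj : Function.Surjective f := Set.range_eq_univ.1 hrange
  have hmax : ((IsLocalRing.maximalIdeal A).map (algebraMap A B)).IsMaximal :=
    hker ▸ RingHom.ker_isMaximal_of_surjective f hsurj
  have hlocal : IsLocalRing B := .of_unique_max_ideal
    ⟨_, hmax, fun M hM => IsLocalRing.eq_map_maximalIdeal_of_isMaximal hmax M⟩
  let e : (B ⧸ (IsLocalRing.maximalIdeal A).map (algebraMap A B)) ≃ₐ[A] L :=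
    (Ideal.quotientEquivAlgOfEq A hker.symm).trans
      (Ideal.quotientKerAlgEquivOfSurjective hsurj)
  refine ⟨B, inferInstance, inferInstance, hlocal, FaithfulSMul.algebraMap_injective A B,
    inferInstance, ?_, (IsLocalRing.eq_maximalIdeal hmax).symm, ⟨e⟩⟩
  rw [← IsLocalRing.finrank_quotient_map (R := A) (S := B)]
  let _ : Algebra (A ⧸ IsLocalRing.maximalIdeal A) L :=
    inferInstanceAs (Algebra (IsLocalRing.ResidueField A) L)
  have : IsScalarTower A (A ⧸ IsLocalRing.maximalIdeal A) L :=
    inferInstanceAs (IsScalarTower A (IsLocalRing.ResidueField A) L)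
  exact (e.extendScalarsOfSurjective
    (S := A ⧸ IsLocalRing.maximalIdeal A) Ideal.Quotient.mk_surjective).toLinearEquiv.finrank_eq
end

section
/- Let (A, 𝔪, k) be a Noetherian local ring and A ⊆ B an extension of commutative rings such that B is a free A-module of finite rank N. Then B is semilocal, every maximal ideal 𝔫 of B lies over 𝔪, and for each maximal ideal 𝔫 of B the localisation B_𝔫 satisfies depth_A A = depth_{B_𝔫} B_𝔫. In particular, A is Cohen–Macaulay if and only if B_𝔫 is Cohen–Macaulay for every (equivalently, some) maximal ideal 𝔫 of B. -/
open CategoryTheory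

/-- `Ext^i_R(M, N)`, as an `R`-module, computed via projective resolutions. -/
noncomputable def extMod (R : Type) [CommRing R] (i : ℕ) (M N : ModuleCat.{0} R) :
    ModuleCat R :=
  ((_root_.Ext R (ModuleCat.{0} R) i).obj (Opposite.op M)).obj N

/-- The depth of a local ring `A`, `inf { i | Ext^i(k, A) ≠ 0 }` where `k` is the
residue field. -/
noncomputable def ringDepth (A : Type) [CommRing A] [IsLocalRing A] : ℕ :=
  sInf {i : ℕ |
    ¬ Subsingleton (extMod A i (ModuleCat.of A (IsLocalRing.ResidueField A))
      (ModuleCat.of A A))}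

/-- A Noetherian local ring is Cohen--Macaulay if its depth equals its Krull dimension. -/
def IsCohenMacaulayLocal (A : Type) [CommRing A] [IsLocalRing A] : Prop :=
  (ringDepth A : WithBot ℕ∞) = ringKrullDim A

open CategoryTheory IsLocalRing RingTheory.Sequence

section ExtComparison

variable (R : Type) [CommRing R] (M N : ModuleCat.{0} R)

theorem subsingleton_extMod_zero_iff :
    Subsingleton (extMod R 0 M N) ↔ Subsingleton (Abelian.Ext M N 0) := by
  let P := projectiveResolution M
  have h1 : Subsingleton (extMod R 0 M N) ↔ ∀ f : P.complex.X 0 ⟶ N,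
      P.complex.d 1 0 ≫ f = 0 → f = 0 := by
    rw [← ModuleCat.isZero_iff_subsingleton, extMod, (P.isoExt 0 N).isZero_iff,
      ← HomologicalComplex.exactAt_iff_isZero_homology,
      HomologicalComplex.exactAt_iff' _ 0 0 1 (by simp) (by simp),
      ShortComplex.moduleCat_exact_iff]
    have h0 : ((P.complex.linearYonedaObj R N).sc' 0 0 1).f = 0 :=
      (P.complex.linearYonedaObj R N).shape 0 0 (by simp)
    simp only [h0]
    constructor
    · intro h f hf
      obtain ⟨g, hg⟩ := h f hf
      exact hg.symm
    · intro h f hf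
      exact ⟨0, (h f hf).symm⟩
  rw [h1, Abelian.Ext.homEquiv₀.subsingleton_congr]
  constructor
  · intro h
    refine subsingleton_of_forall_eq 0 fun α ↦ ?_
    have hc := h (P.π.f 0 ≫ α) ((Category.assoc _ _ _).symm.trans
      ((congrArg (· ≫ α) P.complex_d_comp_π_f_zero).trans Limits.zero_comp))
    exact (cancel_epi (P.π.f 0)).1 (hc.trans Limits.comp_zero.symm)
  · intro h f hf
    obtain ⟨g, hg⟩ := Limits.CokernelCofork.IsColimit.desc' P.isColimitCokernelCofork f hf
    have hg0 : g = 0 := h.elim (α := M ⟶ N) g 0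
    rw [← hg, hg0, Limits.comp_zero]

theorem subsingleton_extMod_succ_iff (i : ℕ) :
    Subsingleton (extMod R (i + 1) M N) ↔ Subsingleton (Abelian.Ext M N (i + 1)) := by
  let P := projectiveResolution M
  have h1 : Subsingleton (extMod R (i + 1) M N) ↔ ∀ f : P.complex.X (i + 1) ⟶ N,
      P.complex.d (i + 2) (i + 1) ≫ f = 0 → ∃ g : P.complex.X i ⟶ N,
        P.complex.d (i + 1) i ≫ g = f := by
    rw [← ModuleCat.isZero_iff_subsingleton, extMod, (P.isoExt (i + 1) N).isZero_iff,
      ← HomologicalComplex.exactAt_iff_isZero_homology,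
      HomologicalComplex.exactAt_iff' _ i (i + 1) (i + 2) (by simp) (by simp),
      ShortComplex.moduleCat_exact_iff]
    rfl
  rw [h1]
  constructor
  · intro h
    refine subsingleton_of_forall_eq 0 fun α ↦ ?_
    obtain ⟨f, hf, rfl⟩ := P.extMk_surjective α (i + 2) rfl
    exact (P.extMk_eq_zero_iff f _ rfl hf i rfl).2 (h f hf)
  · intro h f hf
    exact (P.extMk_eq_zero_iff f _ rfl hf i rfl).1 (Subsingleton.elim _ _)

theorem subsingleton_extMod_iff (i : ℕ) :
    Subsingleton (extMod R i M N) ↔ Subsingleton (Abelian.Ext M N i) := by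
  cases i with
  | zero => exact subsingleton_extMod_zero_iff R M N
  | succ i => exact subsingleton_extMod_succ_iff R M N i

end ExtComparison

section RegularSequence

universe u

variable {R : Type u} [CommRing R] [IsLocalRing R]

theorem maximalIdeal_smul_top_lt_top (M : Type*) [AddCommGroup M] [Module R M] [Module.Finite R M]
    [Nontrivial M] : maximalIdeal R • (⊤ : Submodule R M) < ⊤ :=
  lt_top_iff_ne_top.2 (Submodule.top_ne_ideal_smul_of_le_jacobson_annihilator
    (maximalIdeal_le_jacobson _)).symm

variable [IsNoetherianRing R]

/-- For a finite module `M` over a Noetherian local ring, `Ext^i(k, M) = 0` for all `i < n` iff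
there is an `M`-regular sequence of length `n` in the maximal ideal. -/
theorem forall_subsingleton_ext_iff_exists_isRegular (M : Type u) [AddCommGroup M] [Module R M]
    [Module.Finite R M] [Nontrivial M] (n : ℕ) :
    (∀ i < n, Subsingleton
      (Abelian.Ext (ModuleCat.of R (ResidueField R)) (ModuleCat.of R M) i)) ↔
    ∃ rs : List R, rs.length = n ∧ (∀ r ∈ rs, r ∈ maximalIdeal R) ∧ IsRegular M rs := by
  have hsupp : Module.support R (ResidueField R) =
      PrimeSpectrum.zeroLocus (maximalIdeal R : Set R) := by
    change Module.support R (R ⧸ maximalIdeal R) = _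
    rw [Module.support_eq_zeroLocus, Ideal.annihilator_quotient]
  have : Module.Finite R (ResidueField R) :=
    inferInstanceAs (Module.Finite R (R ⧸ maximalIdeal R))
  constructor
  · exact ModuleCat.exists_isRegular_of_exists_subsingleton_ext (maximalIdeal R) n
      (ModuleCat.of R M) (maximalIdeal_smul_top_lt_top M) (ModuleCat.of R (ResidueField R)) hsupp
  · rintro ⟨rs, rfl, mem, reg⟩
    exact ModuleCat.subsingleton_ext_of_exists_isRegular (maximalIdeal R)
      (ModuleCat.of R (ResidueField R)) hsupp.subset (ModuleCat.of R M)
      (maximalIdeal_smul_top_lt_top M) rs mem reg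

/-- A regular sequence in the maximal ideal that is shorter than another one can be extended. -/
theorem exists_isRegular_append_singleton (M : Type u) [AddCommGroup M] [Module R M]
    [Module.Finite R M] {rs rs' : List R} (mem : ∀ r ∈ rs, r ∈ maximalIdeal R)
    (reg : IsRegular M rs) (len : rs'.length = rs.length + 1)
    (mem' : ∀ r ∈ rs', r ∈ maximalIdeal R) (reg' : IsRegular M rs') :
    ∃ y ∈ maximalIdeal R, IsRegular M (rs ++ [y]) := by
  induction rs generalizing M rs' with
  | nil =>
    obtain ⟨y, rfl⟩ := List.length_eq_one_iff.1 len
    exact ⟨y, mem' y (by simp), reg'⟩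
  | cons x rs ih =>
    have : Nontrivial M := reg.nontrivial
    rw [isRegular_cons_iff] at reg
    have : Nontrivial (QuotSMulTop x M) := reg.2.nontrivial
    have hM := (forall_subsingleton_ext_iff_exists_isRegular M _).2 ⟨rs', len, mem', reg'⟩
    obtain ⟨ss, hlen, hmem, hreg⟩ :=
      (forall_subsingleton_ext_iff_exists_isRegular (QuotSMulTop x M) (rs.length + 1)).1
      fun i hi ↦ by
        have zero1 := AddCommGrpCat.isZero_of_iff_subsingleton.mpr
          (hM i (by simp only [List.length_cons]; lia))
        have zero2 := AddCommGrpCat.isZero_of_iff_subsingleton.mpr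
          (hM (i + 1) (by simp only [List.length_cons]; lia))
        have hx : IsSMulRegular (ModuleCat.of R M) x := reg.1
        exact AddCommGrpCat.subsingleton_of_isZero <| ShortComplex.Exact.isZero_of_both_zeros
          (Abelian.Ext.covariant_sequence_exact₃' _ hx.smulShortComplex_shortExact i (i + 1) rfl)
          (zero1.eq_zero_of_src _) (zero2.eq_zero_of_tgt _)
    obtain ⟨y, hy, hys⟩ := ih (QuotSMulTop x M) (fun r hr ↦ mem r (by simp [hr])) reg.2 hlen
      hmem hreg
    exact ⟨y, hy, (isRegular_cons_iff M x _).2 ⟨reg.1, hys⟩⟩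

theorem exists_isRegular_forall_not_isRegular_append_singleton (R : Type*) [CommRing R]
    [IsLocalRing R] [IsNoetherianRing R] :
    ∃ rs : List R, (∀ r ∈ rs, r ∈ maximalIdeal R) ∧ IsRegular R rs ∧
      ∀ y ∈ maximalIdeal R, ¬ IsRegular R (rs ++ [y]) := by
  by_contra! h
  have key (n : ℕ) : ∃ rs : List R, rs.length = n ∧ (∀ r ∈ rs, r ∈ maximalIdeal R) ∧
      IsRegular R rs := by
    induction n with
    | zero => exact ⟨[], rfl, by simp, IsRegular.nil R R⟩
    | succ n ih =>
      obtain ⟨rs, hn, hrs, hreg⟩ := ih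
      obtain ⟨y, hy, hy'⟩ := h rs hrs hreg
      refine ⟨rs ++ [y], by simp [hn], ?_, hy'⟩
      simp only [List.mem_append, List.mem_singleton]
      rintro r (hr | rfl)
      exacts [hrs r hr, hy]
  obtain ⟨d, hd⟩ : ∃ d : ℕ, ringKrullDim R = d := by
    obtain ⟨d, hd⟩ := ENat.ne_top_iff_exists.1 (Ideal.height_ne_top
      (I := maximalIdeal R) (Ideal.IsPrime.ne_top inferInstance))
    exact ⟨d, by rw [← maximalIdeal_height_eq_ringKrullDim, ← hd]; rfl⟩
  obtain ⟨rs, hn, hrs, hreg⟩ := key (d + 1)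
  have hnt : Nontrivial (R ⧸ Ideal.ofList rs) := Ideal.Quotient.nontrivial_iff.2 fun h ↦
    hreg.2 (by rw [h]; simp)
  have h1 := ringKrullDim_add_length_eq_ringKrullDim_of_isRegular rs hreg
  have h2 : (0 : WithBot ℕ∞) ≤ ringKrullDim (R ⧸ Ideal.ofList rs) :=
    ringKrullDim_nonneg_of_nontrivial
  have h3 : ((d + 1 : ℕ) : WithBot ℕ∞) ≤ d := by
    rw [← hd, ← h1, hn]
    exact le_add_of_nonneg_left h2
  have h4 : d + 1 ≤ d := by exact_mod_cast h3
  lia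

end RegularSequence

/-- The depth of a Noetherian local ring is the length of any maximal regular sequence. -/
theorem ringDepth_eq_length (R : Type) [CommRing R] [IsLocalRing R] [IsNoetherianRing R]
    {rs : List R} (mem : ∀ r ∈ rs, r ∈ maximalIdeal R) (reg : IsRegular R rs)
    (max : ∀ y ∈ maximalIdeal R, ¬ IsRegular R (rs ++ [y])) : ringDepth R = rs.length := by
  have hlt := (forall_subsingleton_ext_iff_exists_isRegular R rs.length).2 ⟨rs, rfl, mem, reg⟩
  have heq : ¬ Subsingleton (Abelian.Ext (ModuleCat.of R (ResidueField R))
      (ModuleCat.of R R) rs.length) := by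
    intro h
    obtain ⟨rs', hlen, mem', reg'⟩ :=
      (forall_subsingleton_ext_iff_exists_isRegular R (rs.length + 1)).1 fun i hi ↦ by
        rcases (Nat.lt_succ_iff_lt_or_eq.1 hi) with hi | rfl
        exacts [hlt i hi, h]
    obtain ⟨y, hy, hreg⟩ := exists_isRegular_append_singleton R mem reg hlen mem' reg'
    exact max y hy hreg
  simp only [ringDepth, subsingleton_extMod_iff]
  refine le_antisymm (Nat.sInf_le heq) (le_csInf ⟨_, heq⟩ fun i hi ↦ ?_)
  by_contra! h
  exact hi (hlt i h)

/-- For a maximal regular sequence `rs`, the maximal ideal is the annihilator of a nonzero element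
of `R ⧸ (rs)`. -/
theorem exists_notMem_ofList_of_forall_not_isRegular {R : Type*} [CommRing R] [IsLocalRing R]
    [IsNoetherianRing R] {rs : List R} (mem : ∀ r ∈ rs, r ∈ maximalIdeal R) (reg : IsRegular R rs)
    (max : ∀ y ∈ maximalIdeal R, ¬ IsRegular R (rs ++ [y])) :
    ∃ a ∉ Ideal.ofList rs, ∀ y ∈ maximalIdeal R, y * a ∈ Ideal.ofList rs := by
  let M := R ⧸ (Ideal.ofList rs • ⊤ : Submodule R R)
  have hsub : ¬ Subsingleton (ResidueField R →ₗ[R] M) := by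
    have : Module.Finite R (ResidueField R) :=
      inferInstanceAs (Module.Finite R (R ⧸ maximalIdeal R))
    rw [IsSMulRegular.subsingleton_linearMap_iff]
    rintro ⟨y, hy, hyreg⟩
    have hym : y ∈ maximalIdeal R := by
      change y ∈ Module.annihilator R (R ⧸ maximalIdeal R) at hy
      rwa [Ideal.annihilator_quotient] at hy
    refine max y hym ?_
    rw [isRegular_iff_isWeaklyRegular_of_subset_maximalIdeal, isWeaklyRegular_append_iff,
      isWeaklyRegular_singleton_iff]
    · exact ⟨reg.1, hyreg⟩
    · simp only [List.mem_append, List.mem_singleton]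
      rintro r (hr | rfl)
      exacts [mem r hr, hym]
  obtain ⟨f, hf⟩ := not_forall.1 (mt (subsingleton_of_forall_eq 0) hsub)
  have hf1 : f 1 ≠ 0 := by
    refine fun h ↦ hf (LinearMap.ext fun z ↦ ?_)
    obtain ⟨r, rfl⟩ := IsLocalRing.residue_surjective z
    have : IsLocalRing.residue R r = r • (1 : ResidueField R) := by
      rw [Algebra.smul_def, mul_one]; rfl
    rw [this, map_smul, h, smul_zero, LinearMap.zero_apply]
  obtain ⟨a, ha⟩ := Submodule.Quotient.mk_surjective _ (f 1)
  refine ⟨a, fun h ↦ hf1 ?_, fun y hy ↦ ?_⟩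
  · rw [← ha, Submodule.Quotient.mk_eq_zero]
    simpa using h
  · have h0 : y • (1 : ResidueField R) = 0 := by
      rw [Algebra.smul_def, mul_one]
      exact (IsLocalRing.residue_eq_zero_iff y).2 hy
    have : y • f 1 = 0 := by
      rw [← f.map_smul, h0, f.map_zero]
    rw [← ha, ← Submodule.Quotient.mk_smul, Submodule.Quotient.mk_eq_zero] at this
    simpa using this

/-- Depth is preserved along a flat local homomorphism `R → S` of Noetherian local rings whose
closed fibre is Artinian. -/
theorem ringDepth_eq_of_flat_of_le_radical (R S : Type) [CommRing R] [IsLocalRing R]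
    [IsNoetherianRing R] [CommRing S] [IsLocalRing S] [IsNoetherianRing S] [Algebra R S]
    [Module.Flat R S] [IsLocalHom (algebraMap R S)]
    (h : maximalIdeal S ≤ ((maximalIdeal R).map (algebraMap R S)).radical) :
    ringDepth R = ringDepth S := by
  have : Module.FaithfullyFlat R S := Module.FaithfullyFlat.of_flat_of_isLocalHom
  obtain ⟨rs, mem, reg, max⟩ := exists_isRegular_forall_not_isRegular_append_singleton R
  have mem' : ∀ r ∈ rs.map (algebraMap R S), r ∈ maximalIdeal S := by
    simp only [List.mem_map]
    rintro _ ⟨r, hr, rfl⟩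
    exact map_nonunit (algebraMap R S) r (mem r hr)
  rw [ringDepth_eq_length R mem reg max,
    ringDepth_eq_length S mem' (IsRegular.of_faithfullyFlat reg), List.length_map]
  intro y hy hreg
  obtain ⟨a, ha, hma⟩ := exists_notMem_ofList_of_forall_not_isRegular mem reg max
  obtain ⟨k, hk⟩ := h hy
  have hle : (maximalIdeal R).map (algebraMap R S) ≤
      Submodule.comap (LinearMap.toSpanSingleton S S (algebraMap R S a))
        (Ideal.ofList (rs.map (algebraMap R S))) := by
    rw [Ideal.map_le_iff_le_comap]
    intro z hz
    change algebraMap R S z * algebraMap R S a ∈ Ideal.ofList (rs.map (algebraMap R S))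
    rw [← map_mul, ← Ideal.map_ofList]
    exact Ideal.mem_map_of_mem _ (hma z hz)
  have hyk : y ^ k * algebraMap R S a ∈ Ideal.ofList (rs.map (algebraMap R S)) := hle hk
  have hyreg := ((isWeaklyRegular_append_iff S _ _).1 hreg.1).2
  rw [isWeaklyRegular_singleton_iff] at hyreg
  have h0 := (hyreg.pow k).right_eq_zero_of_smul (x := Submodule.Quotient.mk (algebraMap R S a)) (by
    rw [← Submodule.Quotient.mk_smul, Submodule.Quotient.mk_eq_zero]
    simpa using hyk)
  rw [Submodule.Quotient.mk_eq_zero] at h0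
  refine ha ?_
  rw [← Ideal.comap_map_eq_self_of_faithfullyFlat (B := S) (Ideal.ofList rs), Ideal.map_ofList]
  simpa using h0

section FiniteExtension

variable (A : Type*) {B : Type*} [CommRing A] [IsLocalRing A] [CommRing B] [Algebra A B]
  [Module.Finite A B]

theorem comap_eq_maximalIdeal_of_isMaximal (𝔫 : Ideal B) [𝔫.IsMaximal] :
    Ideal.comap (algebraMap A B) 𝔫 = maximalIdeal A :=
  eq_maximalIdeal (Ideal.isMaximal_comap_of_isIntegral_of_isMaximal 𝔫)

theorem ringKrullDim_localization_eq_of_flat [IsNoetherianRing A] [Module.Flat A B]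
    (𝔫 : Ideal B) [𝔫.IsMaximal] : ringKrullDim (Localization.AtPrime 𝔫) = ringKrullDim A := by
  have : IsNoetherianRing B := IsNoetherianRing.of_finite A B
  have : 𝔫.LiesOver (maximalIdeal A) := ⟨(comap_eq_maximalIdeal_of_isMaximal A 𝔫).symm⟩
  have : IsArtinianRing (B ⧸ (maximalIdeal A).map (algebraMap A B)) :=
    have : IsArtinianRing (A ⧸ maximalIdeal A) :=
      inferInstanceAs (IsArtinianRing (ResidueField A))
    .of_finite (A ⧸ maximalIdeal A) _
  have hle : (maximalIdeal A).map (algebraMap A B) ≤ 𝔫 := by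
    rw [Ideal.map_le_iff_le_comap, comap_eq_maximalIdeal_of_isMaximal]
  have hmax : (𝔫.map (Ideal.Quotient.mk ((maximalIdeal A).map (algebraMap A B)))).IsMaximal :=
    .map_of_surjective_of_ker_le Ideal.Quotient.mk_surjective (by rwa [Ideal.mk_ker])
  have h0 : (𝔫.map (Ideal.Quotient.mk ((maximalIdeal A).map (algebraMap A B)))).height = 0 := by
    have h1 := Ideal.height_le_ringKrullDim_of_ne_top hmax.ne_top
    have : Nontrivial (B ⧸ (maximalIdeal A).map (algebraMap A B)) :=
      Ideal.Quotient.nontrivial_iff.2 (ne_top_of_le_ne_top (Ideal.IsPrime.ne_top inferInstance) hle)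
    rw [ringKrullDimZero_iff_ringKrullDim_eq_zero.1 inferInstance] at h1
    exact nonpos_iff_eq_zero.1 (by exact_mod_cast h1)
  rw [IsLocalization.AtPrime.ringKrullDim_eq_height 𝔫, ← maximalIdeal_height_eq_ringKrullDim,
    Ideal.height_eq_height_add_of_liesOver_of_hasGoingDown (maximalIdeal A) 𝔫, h0, add_zero]

theorem maximalIdeal_localization_le_radical_map (𝔫 : Ideal B) [𝔫.IsMaximal] :
    maximalIdeal (Localization.AtPrime 𝔫) ≤
      ((maximalIdeal A).map (algebraMap A (Localization.AtPrime 𝔫))).radical := by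
  rw [Ideal.radical_eq_sInf]
  refine le_sInf fun Q ⟨hQ, _⟩ ↦ ?_
  let q := Q.comap (algebraMap B (Localization.AtPrime 𝔫))
  have hq : q.comap (algebraMap A B) = maximalIdeal A := by
    refine ((maximalIdeal.isMaximal A).eq_of_le (Ideal.IsPrime.ne_top inferInstance) ?_).symm
    rw [Ideal.comap_comap, ← IsScalarTower.algebraMap_eq, ← Ideal.map_le_iff_le_comap]
    exact hQ
  have hqm : q.IsMaximal := Ideal.isMaximal_of_isIntegral_of_isMaximal_comap (R := A) q
    (hq ▸ maximalIdeal.isMaximal A)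
  have hqn : q = 𝔫 := by
    refine hqm.eq_of_le (Ideal.IsPrime.ne_top inferInstance) ?_
    rw [← IsLocalization.AtPrime.under_maximalIdeal (Localization.AtPrime 𝔫) 𝔫]
    exact Ideal.comap_mono (le_maximalIdeal (Ideal.IsPrime.ne_top inferInstance))
  rw [← Localization.AtPrime.map_eq_maximalIdeal, Ideal.map_le_iff_le_comap]
  exact hqn.ge

theorem isLocalHom_algebraMap_localization (𝔫 : Ideal B) [𝔫.IsMaximal] :
    IsLocalHom (algebraMap A (Localization.AtPrime 𝔫)) := by
  refine ((local_hom_TFAE _).out 0 4).2 ?_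
  rw [IsScalarTower.algebraMap_eq A B, ← Ideal.comap_comap, ← Ideal.under_def B,
    IsLocalization.AtPrime.under_maximalIdeal (Localization.AtPrime 𝔫) 𝔫,
    comap_eq_maximalIdeal_of_isMaximal]

end FiniteExtension

theorem finite_setOf_isMaximal_of_moduleFinite (A B : Type*) [CommRing A] [IsLocalRing A]
    [CommRing B] [Algebra A B] [Module.Finite A B] :
    {𝔫 : Ideal B | 𝔫.IsMaximal}.Finite :=
  (Algebra.QuasiFinite.finite_primesOver (maximalIdeal A) (S := B)).subset fun 𝔫 h𝔫 ↦
    have : 𝔫.IsMaximal := h𝔫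
    ⟨inferInstance, ⟨(comap_eq_maximalIdeal_of_isMaximal A 𝔫).symm⟩⟩

/-- Let `(A, 𝔪, k)` be a Noetherian local ring and `A ⊆ B` a ring
extension with `B` a free `A`-module of finite rank.  Then `B` is semilocal, every maximal
ideal `𝔫` of `B` lies over `𝔪`, and `depth_A A = depth_{B_𝔫} B_𝔫` for every maximal ideal
`𝔫` of `B`.  In particular `A` is Cohen--Macaulay iff `B_𝔫` is Cohen--Macaulay for every
(equivalently, some) maximal ideal `𝔫` of `B`. -/
theorem depth_eq_of_finite_free_extension (A : Type) [CommRing A] [IsLocalRing A]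
    [IsNoetherianRing A] (B : Type) [CommRing B] [Algebra A B]
    (hinj : Function.Injective (algebraMap A B))
    [Module.Free A B] [Module.Finite A B] :
    {𝔫 : Ideal B | 𝔫.IsMaximal}.Finite ∧
    (∀ (𝔫 : Ideal B) (h𝔫 : 𝔫.IsMaximal),
      Ideal.comap (algebraMap A B) 𝔫 = IsLocalRing.maximalIdeal A) ∧
    (∀ (𝔫 : Ideal B) (h𝔫 : 𝔫.IsMaximal),
      ringDepth A = ringDepth (Localization.AtPrime 𝔫)) ∧
    (IsCohenMacaulayLocal A ↔
      ∀ (𝔫 : Ideal B) (h𝔫 : 𝔫.IsMaximal), IsCohenMacaulayLocal (Localization.AtPrime 𝔫)) ∧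
    (IsCohenMacaulayLocal A ↔
      ∃ (𝔫 : Ideal B) (h𝔫 : 𝔫.IsMaximal), IsCohenMacaulayLocal (Localization.AtPrime 𝔫)) := by
  have depth_eq (𝔫 : Ideal B) (h𝔫 : 𝔫.IsMaximal) :
      ringDepth A = ringDepth (Localization.AtPrime 𝔫) := by
    have : IsNoetherianRing B := IsNoetherianRing.of_finite A B
    have : IsNoetherianRing (Localization.AtPrime 𝔫) :=
      IsLocalization.isNoetherianRing 𝔫.primeCompl _ inferInstance
    have := isLocalHom_algebraMap_localization A 𝔫
    have : Module.Flat A (Localization.AtPrime 𝔫) := Module.Flat.trans A B _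
    exact ringDepth_eq_of_flat_of_le_radical A (Localization.AtPrime 𝔫)
      (maximalIdeal_localization_le_radical_map A 𝔫)
  have cm_iff (𝔫 : Ideal B) (h𝔫 : 𝔫.IsMaximal) :
      IsCohenMacaulayLocal A ↔ IsCohenMacaulayLocal (Localization.AtPrime 𝔫) := by
    rw [IsCohenMacaulayLocal, IsCohenMacaulayLocal, depth_eq 𝔫 h𝔫,
      ringKrullDim_localization_eq_of_flat A 𝔫]
  have : Nontrivial B := hinj.nontrivial
  obtain ⟨𝔫₀, h𝔫₀⟩ := Ideal.exists_maximal B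
  exact ⟨finite_setOf_isMaximal_of_moduleFinite A B,
    fun 𝔫 _ ↦ comap_eq_maximalIdeal_of_isMaximal A 𝔫, depth_eq,
    ⟨fun h 𝔫 h𝔫 ↦ (cm_iff 𝔫 h𝔫).1 h, fun h ↦ (cm_iff 𝔫₀ h𝔫₀).2 (h 𝔫₀ h𝔫₀)⟩,
    ⟨fun h ↦ ⟨𝔫₀, h𝔫₀, (cm_iff 𝔫₀ h𝔫₀).1 h⟩, fun ⟨𝔫, h𝔫, h⟩ ↦ (cm_iff 𝔫 h𝔫).2 h⟩⟩
end

section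
/- Let (A, 𝔪, k) be a Noetherian local ring and A ⊆ B an extension of commutative rings such that B is a free A-module of finite rank N. If the localisation B_𝔫 of B at some maximal ideal 𝔫 of B is a Gorenstein local ring, then A is a Gorenstein local ring. -/
open CategoryTheory

/-- A Noetherian local ring `A` is Gorenstein of dimension `m` if it is Cohen--Macaulay
(depth = Krull dimension = `m`) and `Ext^m(k, A) ≅ k`. -/
def IsGorensteinLocalOfDim (A : Type) [CommRing A] [IsLocalRing A] (m : ℕ) : Prop :=
  IsNoetherianRing A ∧ ringKrullDim A = m ∧ ringDepth A = m ∧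
    Nonempty (extMod A m (ModuleCat.of A (IsLocalRing.ResidueField A)) (ModuleCat.of A A)
      ≃ₗ[A] IsLocalRing.ResidueField A)

/-- A Noetherian local ring is Gorenstein if it is Gorenstein of dimension `m`
for some `m`. -/
def IsGorensteinLocal (A : Type) [CommRing A] [IsLocalRing A] : Prop :=
  ∃ m : ℕ, IsGorensteinLocalOfDim A m

section Ext
variable {R : Type} [CommRing R]

/-- Postcomposition on the complexes `Hom(P, -)`. -/
@[simps]
noncomputable def linearYonedaObjMap (P : ChainComplex (ModuleCat.{0} R) ℕ)
    {Y Z : ModuleCat.{0} R} (f : Y ⟶ Z) : P.linearYonedaObj R Y ⟶ P.linearYonedaObj R Z where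
  f i := ((linearYoneda R (ModuleCat.{0} R)).map f).app (Opposite.op (P.X i))
  comm' i j _ := (((linearYoneda R (ModuleCat.{0} R)).map f).naturality (P.d j i).op).symm

/-- `Ext^0` is `Hom`. -/
noncomputable def extModZeroIso (M N : ModuleCat.{0} R) :
    extMod R 0 M N ≅ ModuleCat.of R (M ⟶ N) :=
  haveI : Limits.PreservesLimits ((linearYoneda R (ModuleCat.{0} R)).obj N) :=
    haveI : Limits.PreservesLimits ((linearYoneda R (ModuleCat.{0} R)).obj N ⋙ forget _) :=
      inferInstanceAs (Limits.PreservesLimits (yoneda.obj N))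
    Limits.preservesLimits_of_reflects_of_preserves _ (forget _)
  haveI : Limits.PreservesFiniteColimits ((linearYoneda R (ModuleCat.{0} R)).obj N).rightOp :=
    Limits.preservesFiniteColimits_rightOp _
  ((((linearYoneda R (ModuleCat.{0} R)).obj N).rightOp.leftDerivedZeroIsoSelf).app M).unop.symm

lemma homologyMap_linearYonedaObjMap_smul {X : ModuleCat.{0} R} (P : ProjectiveResolution X)
    (Y : ModuleCat.{0} R) (x : R) (hx : x • 𝟙 X = 0) (i : ℕ) :
    HomologicalComplex.homologyMap (linearYonedaObjMap P.complex (x • 𝟙 Y)) i = 0 := by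
  have h : Homotopy (x • 𝟙 P.complex) 0 := ProjectiveResolution.liftHomotopyZero _ (by
    ext : 1
    have : x • P.π.f 0 = (P.π.f 0) ≫ ((ChainComplex.single₀ _).map (x • 𝟙 X)).f 0 := by
      rw [ChainComplex.single₀_map_f_zero]
      simp
      exact (Category.comp_id _).symm
    exact (show ((x • 𝟙 P.complex) ≫ P.π).f 0 = x • P.π.f 0 by simp).trans
      (this.trans (by
        rw [hx, Functor.map_zero, HomologicalComplex.zero_f, Limits.comp_zero]; rfl)))
  have h' :=
    ((((linearYoneda R (ModuleCat.{0} R)).obj Y).rightOp.mapHomotopy h).unop).homologyMap_eq i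
  refine Eq.trans (congrArg (fun t => HomologicalComplex.homologyMap t i) ?_)
    (h'.trans (Eq.trans (congrArg (fun t => HomologicalComplex.homologyMap t i) ?_)
      (HomologicalComplex.homologyMap_zero _ _ _)))
  · ext j f
    have key (f : P.complex.X j ⟶ Y) : f ≫ (x • 𝟙 Y) = (x • 𝟙 (P.complex.X j)) ≫ f := by simp
    exact key f
  · ext j f
    exact Limits.zero_comp (X := P.complex.X j) (Y := P.complex.X j) (f := f)

lemma shortExact_linearYonedaObjMap {X : ModuleCat.{0} R} (P : ProjectiveResolution X)
    {S : ShortComplex (ModuleCat.{0} R)} (hS : S.ShortExact) :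
    (ShortComplex.mk (linearYonedaObjMap P.complex S.f) (linearYonedaObjMap P.complex S.g)
      (by
        ext i f
        have key (f : P.complex.X i ⟶ S.X₁) : (f ≫ S.f) ≫ S.g = 0 := by simp
        exact key f)).ShortExact := by
  rw [HomologicalComplex.shortExact_iff_degreewise_shortExact]
  intro i
  have := hS.mono_f
  have := hS.epi_g
  refine ModuleCat.shortComplex_shortExact _ ?_ ?_ ?_
  · intro f
    constructor
    · intro hf
      exact ⟨hS.exact.lift f hf, hS.exact.lift_f f hf⟩
    · rintro ⟨g, rfl⟩
      have key (g : P.complex.X i ⟶ S.X₁) : (g ≫ S.f) ≫ S.g = 0 := by simp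
      exact key g
  · intro f g hfg
    exact (cancel_mono S.f).1 hfg
  · intro f
    exact ⟨Projective.factorThru f S.g, Projective.factorThru_comp f S.g⟩

lemma nonempty_extMod_iso_succ {X N N' : ModuleCat.{0} R} (x : R) (hx : x • 𝟙 X = 0)
    (g : N ⟶ N') (w : (x • 𝟙 N) ≫ g = 0) (hS : (ShortComplex.mk _ g w).ShortExact) (i : ℕ)
    (hi : Subsingleton (extMod R i X N)) :
    Nonempty (extMod R i X N' ≅ extMod R (i + 1) X N) := by
  let P := projectiveResolution X
  have hP := shortExact_linearYonedaObjMap P hS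
  have h1 : Mono (hP.δ i (i + 1) rfl) := hP.mono_δ i (i + 1) rfl
    (.of_iso (ModuleCat.isZero_of_subsingleton (extMod R i X N)) (P.isoExt i N).symm)
  have h2 : Epi (hP.δ i (i + 1) rfl) := by
    refine (hP.homology_exact₁ i (i + 1) rfl).epi_f ?_
    exact homologyMap_linearYonedaObjMap_smul P N x hx (i + 1)
  have := isIso_of_mono_of_epi (hP.δ i (i + 1) rfl)
  exact ⟨P.isoExt i N' ≪≫ asIso (hP.δ i (i + 1) rfl) ≪≫ (P.isoExt (i + 1) N).symm⟩

end Ext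

section ResidueField
open IsLocalRing TensorProduct

section
variable {R : Type*} [CommRing R] [IsLocalRing R] {M : Type*} [AddCommGroup M] [Module R M]

lemma exists_residueField_hom {t : M} (ht : ∀ r ∈ maximalIdeal R, r • t = 0) :
    ∃ f : ResidueField R →ₗ[R] M, f 1 = t :=
  ⟨(maximalIdeal R).liftQ (LinearMap.toSpanSingleton R M t) (fun r hr => ht r hr), by
    exact one_smul R t⟩

lemma smul_residueField_hom_one (f : ResidueField R →ₗ[R] M) {r : R} (hr : r ∈ maximalIdeal R) :
    r • f 1 = 0 := by
  rw [← map_smul, Algebra.smul_def, mul_one, ResidueField.algebraMap_eq,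
    (residue_eq_zero_iff r).2 hr, map_zero]

lemma residueField_hom_ext {f g : ResidueField R →ₗ[R] M} (h : f 1 = g 1) : f = g := by
  ext a
  obtain ⟨a, rfl⟩ := residue_surjective a
  rw [← ResidueField.algebraMap_eq, ← mul_one (algebraMap _ _ a), ← Algebra.smul_def, map_smul,
    map_smul, h]

lemma exists_smul_of_residueField_hom_equiv
    (e : (ResidueField R →ₗ[R] M) ≃ₗ[R] ResidueField R) :
    ∃ u : M, (∀ r ∈ maximalIdeal R, r • u = 0) ∧
      ∀ t : M, (∀ r ∈ maximalIdeal R, r • t = 0) → ∃ c : R, t = c • u := by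
  refine ⟨e.symm 1 1, fun r hr => smul_residueField_hom_one _ hr, fun t ht => ?_⟩
  obtain ⟨f, rfl⟩ := exists_residueField_hom ht
  obtain ⟨c, hc⟩ := residue_surjective (e f)
  refine ⟨c, ?_⟩
  rw [← LinearMap.smul_apply, ← map_smul, Algebra.smul_def, mul_one, ResidueField.algebraMap_eq, hc,
    e.symm_apply_apply]

lemma nonempty_residueField_hom_equiv {v : M} (hv : v ≠ 0)
    (hv' : ∀ r ∈ maximalIdeal R, r • v = 0)
    (h : ∀ w : M, (∀ r ∈ maximalIdeal R, r • w = 0) → ∃ c : R, w = c • v) :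
    Nonempty ((ResidueField R →ₗ[R] M) ≃ₗ[R] ResidueField R) := by
  obtain ⟨f, rfl⟩ := exists_residueField_hom hv'
  let φ := LinearMap.toSpanSingleton R (ResidueField R →ₗ[R] M) f
  have hφ : Function.Surjective φ := fun g => by
    obtain ⟨c, hc⟩ := h (g 1) (fun r hr => smul_residueField_hom_one g hr)
    exact ⟨c, residueField_hom_ext hc.symm⟩
  have hker : LinearMap.ker φ = maximalIdeal R := by
    ext r
    constructor
    · intro hr
      by_contra hr'
      have hu : IsUnit r := by simpa using hr'
      have : r • f 1 = 0 := by
        rw [← LinearMap.smul_apply]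
        have : r • f = 0 := hr
        rw [this, LinearMap.zero_apply]
      exact hv (hu.smul_eq_zero.1 this)
    · intro hr
      exact residueField_hom_ext (smul_residueField_hom_one f hr)
  exact ⟨((Submodule.quotEquivOfEq _ _ hker).symm.trans (φ.quotKerEquivOfSurjective hφ)).symm⟩

lemma subsingleton_residueField_hom {x : R} (hx : x ∈ maximalIdeal R) (hreg : IsSMulRegular M x) :
    Subsingleton (ResidueField R →ₗ[R] M) :=
  hreg.linearMap_subsingleton_of_mem_annihilator (by
    rw [Module.mem_annihilator]
    intro a
    rw [Algebra.smul_def, ResidueField.algebraMap_eq, (residue_eq_zero_iff x).2 hx, zero_mul])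

lemma exists_isSMulRegular_of_subsingleton [IsNoetherianRing R] [Module.Finite R M]
    (h : Subsingleton (ResidueField R →ₗ[R] M)) : ∃ x ∈ maximalIdeal R, IsSMulRegular M x := by
  obtain ⟨x, hx, hreg⟩ := IsSMulRegular.subsingleton_linearMap_iff.1 h
  refine ⟨x, (residue_eq_zero_iff x).1 ?_, hreg⟩
  rw [← ResidueField.algebraMap_eq, ← mul_one (algebraMap _ _ x), ← Algebra.smul_def]
  exact Module.mem_annihilator.1 hx 1

end

section
variable {A C : Type*} [CommRing A] [CommRing C] [Algebra A C]

lemma smul_tmul_eq_zero_of_mem_map {I : Ideal A} {M : Type*} [AddCommGroup M] [Module A M] {v : M}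
    (hv : ∀ a ∈ I, a • v = 0) {z : C} (hz : z ∈ I.map (algebraMap A C)) : z ⊗ₜ[A] v = 0 := by
  induction hz using Submodule.span_induction with
  | mem z hz =>
    obtain ⟨a, ha, rfl⟩ := hz
    rw [Algebra.algebraMap_eq_smul_one, TensorProduct.smul_tmul, hv a ha, TensorProduct.tmul_zero]
  | zero => exact TensorProduct.zero_tmul _ _
  | add z z' _ _ h h' => rw [TensorProduct.add_tmul, h, h', add_zero]
  | smul c z _ h => rw [← TensorProduct.smul_tmul', h, smul_zero]

variable [IsLocalRing A]

lemma tmul_residueField_one_ne_zero {y : C} (hy : y ∉ (maximalIdeal A).map (algebraMap A C)) :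
    y ⊗ₜ[A] (1 : ResidueField A) ≠ 0 := by
  intro h
  apply hy
  rw [← Ideal.Quotient.eq_zero_iff_mem]
  apply (Algebra.TensorProduct.quotIdealMapEquivTensorQuot C (maximalIdeal A)).injective
  rw [map_zero]
  exact h

lemma tmul_ne_smul_tmul_of_residueField {V : Type*} [AddCommGroup V] [Module A V]
    [Module (ResidueField A) V] [IsScalarTower A (ResidueField A) V]
    {y : C} (hy : y ∉ (maximalIdeal A).map (algebraMap A C)) {v w : V}
    (hwv : w ∉ Submodule.span (ResidueField A) {v}) (c : C) :
    y ⊗ₜ[A] w ≠ c • (y ⊗ₜ[A] v) := by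
  obtain ⟨ψ, hψv, hψw⟩ := LinearMap.exists_extend_of_notMem
    (0 : Submodule.span (ResidueField A) {v} →ₗ[ResidueField A] ResidueField A) hwv 1
  have hψv : ψ v = 0 := LinearMap.congr_fun hψv ⟨v, Submodule.mem_span_singleton_self v⟩
  intro h
  rw [TensorProduct.smul_tmul'] at h
  have h' := congrArg ((ψ.restrictScalars A).lTensor C) h
  simp only [LinearMap.lTensor_tmul, LinearMap.restrictScalars_apply, hψv, hψw,
    TensorProduct.tmul_zero] at h'
  exact tmul_residueField_one_ne_zero hy h'

lemma tmul_ne_smul_tmul [Module.Flat A C] {M : Type*} [AddCommGroup M] [Module A M]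
    {y : C} (hy : y ∉ (maximalIdeal A).map (algebraMap A C)) {v w : M}
    (hv : ∀ a ∈ maximalIdeal A, a • v = 0) (hw : ∀ a ∈ maximalIdeal A, a • w = 0)
    (hwv : w ∉ Submodule.span A {v}) (c : C) : y ⊗ₜ[A] w ≠ c • (y ⊗ₜ[A] v) := by
  let V := Submodule.torsionBySet A M (maximalIdeal A)
  let v' : V := ⟨v, (Submodule.mem_torsionBySet_iff _ _).2 fun a => hv a a.2⟩
  let w' : V := ⟨w, (Submodule.mem_torsionBySet_iff _ _).2 fun a => hw a a.2⟩
  have hV : Module.IsTorsionBySet A V (maximalIdeal A) := Submodule.torsionBySet_isTorsionBySet _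
  let : Module (ResidueField A) V := hV.module
  have : IsScalarTower A (ResidueField A) V := hV.isScalarTower
  have hw'v' : w' ∉ Submodule.span (ResidueField A) {v'} := by
    intro h
    obtain ⟨a, ha⟩ := Submodule.mem_span_singleton.1 h
    obtain ⟨a, rfl⟩ := residue_surjective a
    apply hwv
    rw [← ResidueField.algebraMap_eq, algebraMap_smul] at ha
    exact Submodule.mem_span_singleton.2 ⟨a, congrArg Subtype.val ha⟩
  intro h
  refine tmul_ne_smul_tmul_of_residueField hy hw'v' c ?_
  apply Module.Flat.lTensor_preserves_injective_linearMap (M := C) V.subtype V.injective_subtype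
  simpa [TensorProduct.smul_tmul'] using h

lemma smul_tmul_eq_zero_of_mem_maximalIdeal [IsLocalRing C] {M : Type*} [AddCommGroup M]
    [Module A M] {y : C}
    (hy' : ∀ r ∈ maximalIdeal C, r * y ∈ (maximalIdeal A).map (algebraMap A C)) {v : M}
    (hv : ∀ a ∈ maximalIdeal A, a • v = 0) (r : C) (hr : r ∈ maximalIdeal C) :
    r • (y ⊗ₜ[A] v) = 0 :=
  smul_tmul_eq_zero_of_mem_map hv (hy' r hr)

variable [IsLocalRing C] [Module.Flat A C] {M : Type*} [AddCommGroup M] [Module A M]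

lemma subsingleton_residueField_hom_of_baseChange
    {y : C} (hy : y ∉ (maximalIdeal A).map (algebraMap A C))
    (hy' : ∀ r ∈ maximalIdeal C, r * y ∈ (maximalIdeal A).map (algebraMap A C))
    (h : Subsingleton (ResidueField C →ₗ[C] C ⊗[A] M)) :
    Subsingleton (ResidueField A →ₗ[A] M) := by
  refine subsingleton_of_forall_eq 0 fun f => residueField_hom_ext ?_
  by_contra hf
  have hf1 := fun a ha => smul_residueField_hom_one f (r := a) ha
  obtain ⟨g, hg⟩ := exists_residueField_hom (R := C) (M := C ⊗[A] M)
    (smul_tmul_eq_zero_of_mem_maximalIdeal hy' hf1)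
  refine tmul_ne_smul_tmul hy (v := 0) (fun a _ => smul_zero a) hf1 (by simpa using hf) 0 ?_
  rw [zero_smul, ← hg, Subsingleton.elim g 0, LinearMap.zero_apply]

lemma nonempty_residueField_hom_equiv_of_baseChange [IsNoetherianRing A] [Module.Finite A M]
    (hAC : (maximalIdeal A).map (algebraMap A C) ≤ maximalIdeal C)
    {y : C} (hy : y ∉ (maximalIdeal A).map (algebraMap A C))
    (hy' : ∀ r ∈ maximalIdeal C, r * y ∈ (maximalIdeal A).map (algebraMap A C))
    (e : (ResidueField C →ₗ[C] C ⊗[A] M) ≃ₗ[C] ResidueField C) :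
    Nonempty ((ResidueField A →ₗ[A] M) ≃ₗ[A] ResidueField A) := by
  have hA : ¬ Subsingleton (ResidueField A →ₗ[A] M) := by
    intro h
    obtain ⟨x, hx, hreg⟩ := exists_isSMulRegular_of_subsingleton h
    have := hreg.lTensor C
    have : IsSMulRegular (C ⊗[A] M) (algebraMap A C x) := by
      intro a b hab
      exact this (by simpa using hab)
    have := subsingleton_residueField_hom (R := C) (M := C ⊗[A] M)
      (hAC (Ideal.mem_map_of_mem _ hx)) this
    exact not_subsingleton _ e.symm.subsingleton
  rw [not_subsingleton_iff_nontrivial] at hA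
  obtain ⟨f, hf⟩ := exists_ne (0 : ResidueField A →ₗ[A] M)
  have hf0 : f 1 ≠ 0 := fun h => hf (residueField_hom_ext h)
  have hf1 := fun a ha => smul_residueField_hom_one f (r := a) ha
  obtain ⟨u, hu0, hu⟩ := exists_smul_of_residueField_hom_equiv e
  obtain ⟨c, hc⟩ := hu _ (smul_tmul_eq_zero_of_mem_maximalIdeal hy' hf1)
  have hcu : IsUnit c := by
    by_contra hcu
    refine tmul_ne_smul_tmul hy (v := 0) (fun a _ => smul_zero a) hf1 (by simpa using hf0) 0 ?_
    rw [zero_smul, hc, hu0 c hcu]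
  refine nonempty_residueField_hom_equiv hf0 hf1 fun w hw => ?_
  by_contra! hwv
  obtain ⟨d, hd⟩ := hu _ (smul_tmul_eq_zero_of_mem_maximalIdeal hy' hw)
  refine tmul_ne_smul_tmul hy hf1 hw (fun h => ?_) (d * (hcu.unit⁻¹ : Cˣ)) ?_
  · obtain ⟨a, ha⟩ := Submodule.mem_span_singleton.1 h
    exact hwv a ha.symm
  · rw [hd, hc, smul_smul, mul_assoc, IsUnit.val_inv_mul, mul_one]

end

section
variable {R : Type} [CommRing R] [IsLocalRing R]

/-- The first non-vanishing module `Ext^i(k, N)` is `Ext^m(k, N)`, and it is isomorphic to `k`. -/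
def IsFirstExtResidueField (R : Type) [CommRing R] [IsLocalRing R] (m : ℕ) (N : Type)
    [AddCommGroup N] [Module R N] : Prop :=
  (∀ i < m, Subsingleton (extMod R i (ModuleCat.of R (ResidueField R)) (ModuleCat.of R N))) ∧
    Nonempty (extMod R m (ModuleCat.of R (ResidueField R)) (ModuleCat.of R N)
      ≃ₗ[R] ResidueField R)

variable {N N' : Type} [AddCommGroup N] [Module R N] [AddCommGroup N'] [Module R N']

/-- `Ext^0(k, N)` is `Hom(k, N)`. -/
noncomputable def extModZeroEquiv :
    extMod R 0 (ModuleCat.of R (ResidueField R)) (ModuleCat.of R N) ≃ₗ[R]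
      (ResidueField R →ₗ[R] N) :=
  (extModZeroIso _ _).toLinearEquiv.trans (ModuleCat.homLinearEquiv (S := R))

/-- `Ext^i(M, -)` on linear equivalences. -/
noncomputable def extModCongr (i : ℕ) (M : ModuleCat.{0} R) (e : N ≃ₗ[R] N') :
    extMod R i M (ModuleCat.of R N) ≃ₗ[R] extMod R i M (ModuleCat.of R N') :=
  (((_root_.Ext R (ModuleCat.{0} R) i).obj (Opposite.op M)).mapIso e.toModuleIso).toLinearEquiv

lemma IsFirstExtResidueField.congr (e : N ≃ₗ[R] N') {m : ℕ} (h : IsFirstExtResidueField R m N) :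
    IsFirstExtResidueField R m N' :=
  ⟨fun i hi => have := h.1 i hi; (extModCongr i _ e).symm.subsingleton,
    h.2.map (extModCongr m _ e).symm.trans⟩

lemma isFirstExtResidueField_zero :
    IsFirstExtResidueField R 0 N ↔
      Nonempty ((ResidueField R →ₗ[R] N) ≃ₗ[R] ResidueField R) :=
  ⟨fun h => h.2.map extModZeroEquiv.symm.trans,
    fun h => ⟨by simp, h.map extModZeroEquiv.trans⟩⟩

lemma nonempty_extMod_equiv_succ {x : R} (hx : x ∈ maximalIdeal R) (hreg : IsSMulRegular N x)
    {g : N →ₗ[R] N'} (hg : Function.Surjective g) (hxg : Function.Exact (x • · : N → N) g) (i : ℕ)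
    (hi : Subsingleton (extMod R i (ModuleCat.of R (ResidueField R)) (ModuleCat.of R N))) :
    Nonempty (extMod R i (ModuleCat.of R (ResidueField R)) (ModuleCat.of R N') ≃ₗ[R]
      extMod R (i + 1) (ModuleCat.of R (ResidueField R)) (ModuleCat.of R N)) := by
  have hk : x • 𝟙 (ModuleCat.of R (ResidueField R)) = 0 := by
    ext : 1
    exact residueField_hom_ext (smul_residueField_hom_one LinearMap.id hx)
  refine (nonempty_extMod_iso_succ x hk (ModuleCat.ofHom g) ?_ ?_ i hi).map Iso.toLinearEquiv
  · ext n
    exact hxg.apply_apply_eq_zero n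
  · exact ModuleCat.shortComplex_shortExact _ hxg hreg hg

lemma isFirstExtResidueField_succ_iff {x : R} (hx : x ∈ maximalIdeal R) (hreg : IsSMulRegular N x)
    {g : N →ₗ[R] N'} (hg : Function.Surjective g) (hxg : Function.Exact (x • · : N → N) g) (m : ℕ) :
    IsFirstExtResidueField R (m + 1) N ↔ IsFirstExtResidueField R m N' := by
  constructor
  · rintro ⟨h, ⟨e⟩⟩
    have key := fun i (hi : i < m + 1) => nonempty_extMod_equiv_succ hx hreg hg hxg i (h i hi)
    refine ⟨fun i hi => ?_, (key m m.lt_succ_self).map (·.trans e)⟩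
    obtain ⟨e'⟩ := key i (by omega)
    have := h (i + 1) (by omega)
    exact e'.subsingleton
  · rintro ⟨h, ⟨e⟩⟩
    have h' : ∀ i < m + 1,
        Subsingleton (extMod R i (ModuleCat.of R (ResidueField R)) (ModuleCat.of R N)) := by
      intro i
      induction i with
      | zero =>
        intro
        have := subsingleton_residueField_hom hx hreg
        exact (extModZeroEquiv (R := R) (N := N)).subsingleton
      | succ i ih =>
        intro hi
        obtain ⟨e'⟩ := nonempty_extMod_equiv_succ hx hreg hg hxg i (ih (by omega))
        have := h i (by omega)
        exact e'.symm.subsingleton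
    refine ⟨h', ?_⟩
    obtain ⟨e'⟩ := nonempty_extMod_equiv_succ hx hreg hg hxg m (h' m m.lt_succ_self)
    exact ⟨e'.symm.trans e⟩

lemma isGorensteinLocalOfDim_iff {m : ℕ} :
    IsGorensteinLocalOfDim R m ↔
      IsNoetherianRing R ∧ ringKrullDim R = m ∧ IsFirstExtResidueField R m R := by
  refine and_congr_right fun _ => and_congr_right fun _ => and_congr_left fun ⟨e⟩ => ?_
  have hm : ¬ Subsingleton (extMod R m (ModuleCat.of R (ResidueField R)) (ModuleCat.of R R)) :=
    fun h => not_subsingleton _ e.symm.subsingleton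
  constructor
  · intro h i hi
    exact not_not.1 (Nat.notMem_of_lt_sInf (h.symm ▸ hi : i < ringDepth R))
  · intro h
    refine le_antisymm (Nat.sInf_le hm) (le_csInf ⟨m, hm⟩ fun i hi => ?_)
    by_contra! him
    exact hi (h i him)

end

section
variable {A C : Type} [CommRing A] [CommRing C] [IsLocalRing A] [IsLocalRing C] [Algebra A C]

/-- In a Noetherian local `A`-algebra `C` with zero-dimensional closed fibre, the closed fibre has a
nonzero socle. -/
lemma exists_notMem_map_and_mul_mem_map [IsNoetherianRing C] [IsLocalHom (algebraMap A C)]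
    (hfib : ∀ P : Ideal C, P.IsPrime → (maximalIdeal A).map (algebraMap A C) ≤ P → P.IsMaximal) :
    ∃ y : C, y ∉ (maximalIdeal A).map (algebraMap A C) ∧
      ∀ r ∈ maximalIdeal C, r * y ∈ (maximalIdeal A).map (algebraMap A C) := by
  set I := (maximalIdeal A).map (algebraMap A C) with hI
  have hIC : I ≤ maximalIdeal C := ((local_hom_TFAE (algebraMap A C)).out 0 2).1 ‹_›
  have hrad : maximalIdeal C ≤ I.radical := by
    rw [Ideal.radical_eq_sInf]
    exact le_sInf fun P hP => (eq_maximalIdeal (hfib P hP.2 hP.1)).ge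
  obtain ⟨n, hn⟩ := I.exists_radical_pow_le_of_fg (IsNoetherian.noetherian _)
  have hex : ∃ n, maximalIdeal C ^ n ≤ I := ⟨n, (Ideal.pow_right_mono hrad n).trans hn⟩
  classical
  obtain ⟨e, he⟩ : ∃ e, Nat.find hex = e + 1 := by
    refine Nat.exists_eq_succ_of_ne_zero fun h => ?_
    have h0 := Nat.find_spec hex
    rw [h, pow_zero, Ideal.one_eq_top] at h0
    exact (Ideal.IsPrime.ne_top inferInstance) (top_le_iff.1 (h0.trans hIC))
  obtain ⟨y, hy, hyI⟩ := SetLike.not_le_iff_exists.1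
    (Nat.find_min hex (he.symm ▸ e.lt_succ_self : e < _))
  refine ⟨y, hyI, fun r hr => Nat.find_spec hex ?_⟩
  rw [he, pow_succ']
  exact Ideal.mul_mem_mul hr hy

variable [Module.Flat A C]

lemma IsFirstExtResidueField.of_baseChange [IsNoetherianRing A]
    (hAC : (maximalIdeal A).map (algebraMap A C) ≤ maximalIdeal C)
    {y : C} (hy : y ∉ (maximalIdeal A).map (algebraMap A C))
    (hy' : ∀ r ∈ maximalIdeal C, r * y ∈ (maximalIdeal A).map (algebraMap A C)) (m : ℕ)
    (M : Type) [AddCommGroup M] [Module A M] [Module.Finite A M]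
    (h : IsFirstExtResidueField C m (C ⊗[A] M)) : IsFirstExtResidueField A m M := by
  induction m generalizing M with
  | zero =>
    obtain ⟨e⟩ := isFirstExtResidueField_zero.1 h
    exact isFirstExtResidueField_zero.2 (nonempty_residueField_hom_equiv_of_baseChange hAC hy hy' e)
  | succ m ih =>
    have h0 := h.1 0 m.succ_pos
    obtain ⟨x, hx, hreg⟩ := exists_isSMulRegular_of_subsingleton
      (subsingleton_residueField_hom_of_baseChange (M := M) hy hy'
        (extModZeroEquiv (R := C)).symm.subsingleton)
    have hregC : IsSMulRegular (C ⊗[A] M) (algebraMap A C x) := fun a b hab =>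
      hreg.lTensor C (by simpa using hab)
    let g := (LinearMap.range (LinearMap.lsmul A M x)).mkQ
    have hg : Function.Surjective g := Submodule.mkQ_surjective _
    have hxg : Function.Exact (LinearMap.lsmul A M x) g := LinearMap.exact_map_mkQ_range _
    refine (isFirstExtResidueField_succ_iff hx hreg hg hxg m).2 (ih _ ?_)
    refine (isFirstExtResidueField_succ_iff (hAC (Ideal.mem_map_of_mem _ hx)) hregC
      (g := g.baseChange C) (g.lTensor_surjective C hg) ?_ m).1 h
    have hx' : (LinearMap.lsmul A M x).lTensor C = x • LinearMap.id := by
      rw [← LinearMap.lTensor_id, ← LinearMap.lTensor_smul]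
      rfl
    intro b
    refine (lTensor_exact C hxg hg b).trans ?_
    simp [hx']

lemma ringKrullDim_eq_of_flat [IsNoetherianRing A] [IsNoetherianRing C]
    [IsLocalHom (algebraMap A C)]
    (hfib : ∀ P : Ideal C, P.IsPrime → (maximalIdeal A).map (algebraMap A C) ≤ P → P.IsMaximal) :
    ringKrullDim A = ringKrullDim C := by
  have hIC : (maximalIdeal A).map (algebraMap A C) ≤ maximalIdeal C :=
    ((local_hom_TFAE (algebraMap A C)).out 0 2).1 ‹_›
  have : Algebra.HasGoingDown A C := .of_flat
  have : (maximalIdeal C).LiesOver (maximalIdeal A) :=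
    ⟨(((local_hom_TFAE (algebraMap A C)).out 0 4 :
      IsLocalHom _ ↔ (maximalIdeal C).comap _ = maximalIdeal A).1 ‹_›).symm⟩
  have hmk : Function.Surjective (Ideal.Quotient.mk ((maximalIdeal A).map (algebraMap A C))) :=
    Ideal.Quotient.mk_surjective
  have hdim : Ring.KrullDimLE 0 (C ⧸ (maximalIdeal A).map (algebraMap A C)) := by
    refine Ring.krullDimLE_zero_iff.2 fun P hP => ?_
    refine Ideal.isMaximal_of_isIntegral_of_isMaximal_comap' _
      (RingHom.isIntegral_of_surjective _ hmk) P (hfib _ (hP.comap _) ?_)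
    exact Ideal.mk_ker.ge.trans (Ideal.ker_le_comap _)
  have hht := Ideal.height_eq_height_add_of_liesOver_of_hasGoingDown (maximalIdeal A)
    (maximalIdeal C)
  have hne : Ideal.map (Ideal.Quotient.mk ((maximalIdeal A).map (algebraMap A C)))
      (maximalIdeal C) ≠ ⊤ := by
    intro h
    apply Ideal.IsPrime.ne_top (I := maximalIdeal C) inferInstance
    rw [← sup_eq_left.2 hIC,
      ← Ideal.mk_ker (I := (maximalIdeal A).map (algebraMap A C)),
      ← Ideal.comap_map_of_surjective' _ hmk, h, Ideal.comap_top]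
  have h0 : (Ideal.map (Ideal.Quotient.mk ((maximalIdeal A).map (algebraMap A C)))
      (maximalIdeal C)).height = 0 := by
    have := (Ideal.height_le_ringKrullDim_of_ne_top
      (I := Ideal.map (Ideal.Quotient.mk ((maximalIdeal A).map (algebraMap A C)))
      (maximalIdeal C)) hne).trans (Ring.krullDimLE_iff.1 hdim)
    simpa using this
  rw [← maximalIdeal_height_eq_ringKrullDim, ← maximalIdeal_height_eq_ringKrullDim, hht, h0,
    add_zero]

/-- Gorenstein descent along a flat local homomorphism with zero-dimensional closed fibre. -/
lemma IsGorensteinLocalOfDim.of_flat [IsNoetherianRing A] [IsLocalHom (algebraMap A C)]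
    (hfib : ∀ P : Ideal C, P.IsPrime → (maximalIdeal A).map (algebraMap A C) ≤ P → P.IsMaximal)
    {m : ℕ} (h : IsGorensteinLocalOfDim C m) : IsGorensteinLocalOfDim A m := by
  rw [isGorensteinLocalOfDim_iff] at h ⊢
  obtain ⟨_, hdim, hext⟩ := h
  obtain ⟨y, hy, hy'⟩ := exists_notMem_map_and_mul_mem_map hfib
  exact ⟨inferInstance, (ringKrullDim_eq_of_flat hfib).trans hdim,
    .of_baseChange (((local_hom_TFAE (algebraMap A C)).out 0 2).1 ‹_›) hy hy' m A
      (hext.congr (AlgebraTensorModule.rid A C C).symm)⟩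

end

end ResidueField

/-- Let `(A, 𝔪, k)` be a Noetherian local ring and `A ⊆ B` a ring
extension with `B` a free `A`-module of finite rank.  If the localisation `B_𝔫` of `B` at
some maximal ideal `𝔫` is a Gorenstein local ring, then `A` is a Gorenstein local ring. -/
theorem isGorenstein_of_finite_free_extension_localization (A : Type) [CommRing A]
    [IsLocalRing A] [IsNoetherianRing A] (B : Type) [CommRing B] [Algebra A B]
    (hinj : Function.Injective (algebraMap A B))
    [Module.Free A B] [Module.Finite A B]
    (𝔫 : Ideal B) (h𝔫 : 𝔫.IsMaximal)
    (hGor : IsGorensteinLocal (Localization.AtPrime 𝔫)) :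
    IsGorensteinLocal A := by
  have : Module.Flat A (Localization.AtPrime 𝔫) := .trans A B _
  have hloc : (IsLocalRing.maximalIdeal (Localization.AtPrime 𝔫)).comap
      (algebraMap A (Localization.AtPrime 𝔫)) = IsLocalRing.maximalIdeal A := by
    rw [IsScalarTower.algebraMap_eq A B (Localization.AtPrime 𝔫), ← Ideal.comap_comap]
    have : (IsLocalRing.maximalIdeal (Localization.AtPrime 𝔫)).comap
      (algebraMap B (Localization.AtPrime 𝔫)) = 𝔫 := Localization.AtPrime.under_maximalIdeal
    rw [this]
    exact IsLocalRing.eq_maximalIdeal (Ideal.isMaximal_comap_of_isIntegral_of_isMaximal 𝔫)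
  have : IsLocalHom (algebraMap A (Localization.AtPrime 𝔫)) :=
    ((IsLocalRing.local_hom_TFAE (algebraMap A (Localization.AtPrime 𝔫))).out 4 0).1 hloc
  refine hGor.imp fun m => IsGorensteinLocalOfDim.of_flat fun P hP hle => ?_
  have hmax : (P.under B).IsMaximal := by
    apply Ideal.isMaximal_of_isIntegral_of_isMaximal_comap (R := A)
    rw [Ideal.under_def, Ideal.comap_comap,
      ← IsScalarTower.algebraMap_eq A B (Localization.AtPrime 𝔫),
      ← (IsLocalRing.maximalIdeal.isMaximal A).eq_of_le (Ideal.IsPrime.ne_top inferInstance)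
        (Ideal.map_le_iff_le_comap.1 hle)]
    infer_instance
  have hP𝔫 : P.under B = 𝔫 := hmax.eq_of_le h𝔫.ne_top <|
    (Ideal.comap_mono (IsLocalRing.le_maximalIdeal hP.ne_top)).trans
      Localization.AtPrime.under_maximalIdeal.le
  rw [← IsLocalization.map_under 𝔫.primeCompl _ P, hP𝔫, Localization.AtPrime.map_eq_maximalIdeal]
  infer_instance
end

section
/- Let (A, 𝔪, k) be a Noetherian local ring and A ⊆ B an extension of commutative rings such that B is a free A-module of finite rank N, B is local with maximal ideal 𝔪·B, and B/𝔪B is a field (a finite extension of k of degree N). If A is a Gorenstein local ring, then B is a Gorenstein local ring. -/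
open CategoryTheory

section BaseChange

open TensorProduct

variable {A B : Type} [CommRing A] [CommRing B]

section DualBaseChange

variable [Algebra A B] [Module.Free A B] [Module.Finite A B]

/-- If `B` is a finite free `A`-algebra, then `B ⊗ Hom_A(M, A) → Hom_A(M, B)` is bijective for
every `A`-module `M`. -/
lemma linearMapRightBaseChangeHom_bijective (M : Type) [AddCommGroup M] [Module A M] :
    Function.Bijective
      (IsBaseChange.linearMapRightBaseChangeHom B M (Algebra.linearMap A B)) := by
  let b := Module.Free.chooseBasis A B
  have sum_repr : ∀ y : B, ∑ i, b.repr y i • b i = y := b.sum_repr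
  rw [Function.bijective_iff_has_inverse]
  refine ⟨fun f ↦ ∑ i, b i ⊗ₜ[A] (b.coord i ∘ₗ f), fun x ↦ ?_, fun f ↦ ?_⟩
  · induction x with
    | zero => simp
    | add x y hx hy =>
      simp only [map_add, LinearMap.comp_add, tmul_add, Finset.sum_add_distrib] at *
      rw [hx, hy]
    | tmul y g =>
      conv_rhs => rw [← sum_repr y, sum_tmul]
      refine Finset.sum_congr rfl fun i _ ↦ ?_
      rw [smul_tmul]
      congr 1
      ext m
      simp [IsBaseChange.linearMapRightBaseChangeHom, mul_comm y, ← Algebra.smul_def,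
        mul_comm (g m)]
  · ext m
    simp only [map_sum, LinearMap.sum_apply]
    conv_rhs => rw [← sum_repr (f m)]
    refine Finset.sum_congr rfl fun i _ ↦ ?_
    simp [IsBaseChange.linearMapRightBaseChangeHom, Algebra.smul_def, mul_comm]

/-- Base change of the dual of an arbitrary module along a finite free algebra. -/
noncomputable def dualBaseChangeEquiv (M : Type) [AddCommGroup M] [Module A M] :
    B ⊗[A] (M →ₗ[A] A) ≃ₗ[B] (B ⊗[A] M →ₗ[B] B) :=
  (LinearEquiv.ofBijective _ (linearMapRightBaseChangeHom_bijective M)).trans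
    (LinearMap.liftBaseChangeEquiv B)

lemma dualBaseChangeEquiv_tmul_tmul (M : Type) [AddCommGroup M] [Module A M]
    (y z : B) (g : M →ₗ[A] A) (m : M) :
    dualBaseChangeEquiv M (y ⊗ₜ g) (z ⊗ₜ m) = z * (y * algebraMap A B (g m)) := by
  simp [dualBaseChangeEquiv, IsBaseChange.linearMapRightBaseChangeHom, mul_left_comm]

end DualBaseChange

section ExtBaseChange

open ModuleCat

variable (f : A →+* B)

instance extendScalars_additive : (extendScalars.{0, 0, 0} f).Additive :=
  (extendRestrictScalarsAdj f).left_adjoint_additive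

instance extendScalars_preservesProjectiveObjects :
    (extendScalars.{0, 0, 0} f).PreservesProjectiveObjects :=
  Functor.preservesProjectiveObjects_of_adjunction_of_preservesEpimorphisms
    (extendRestrictScalarsAdj f)

lemma extendScalars_preservesHomology (hf : f.Flat) :
    (extendScalars.{0, 0, 0} f).PreservesHomology := by
  have := preservesFiniteLimits_extendScalars_of_flat hf
  infer_instance

variable (hfree : letI := f.toAlgebra; Module.Free A B) (hfin : f.Finite)

/-- `dualBaseChangeEquiv`, in terms of morphisms in the module categories. -/
noncomputable def extendScalarsHomIso (X : ModuleCat.{0} A) :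
    (extendScalars.{0, 0, 0} f).obj (of A (X ⟶ of A A)) ≅
      of B ((extendScalars.{0, 0, 0} f).obj X ⟶ of B B) :=
  letI := f.toAlgebra
  haveI : Module.Free A B := hfree
  haveI : Module.Finite A B := hfin
  (extendScalars.{0, 0, 0} f).mapIso (homLinearEquiv (S := A)).toModuleIso ≪≫
    LinearEquiv.toModuleIso (X₁ := B ⊗[A] (X →ₗ[A] A)) (X₂ := B ⊗[A] X →ₗ[B] B)
      (dualBaseChangeEquiv X) ≪≫
    (homLinearEquiv (S := B) (M := (extendScalars.{0, 0, 0} f).obj X)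
      (N := of B B)).symm.toModuleIso

open scoped ChangeOfRings in
lemma extendScalarsHomIso_hom_tmul_tmul (X : ModuleCat.{0} A) (y z : B) (g : X ⟶ of A A)
    (m : X) :
    (show (extendScalars.{0, 0, 0} f).obj X ⟶ of B B from
      (extendScalarsHomIso f hfree hfin X).hom
        (y ⊗ₜ[A,f] (show of A (X ⟶ of A A) from g))) (z ⊗ₜ[A,f] m) =
      (z * (y * f (g.hom m)) : B) := by
  let := f.toAlgebra
  have : Module.Free A B := hfree
  have : Module.Finite A B := hfin
  exact dualBaseChangeEquiv_tmul_tmul X y z g.hom m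

lemma extendScalarsHomIso_naturality {X Y : ModuleCat.{0} A} (h : X ⟶ Y) :
    (extendScalarsHomIso f hfree hfin Y).hom ≫
        ofHom (Linear.leftComp B (of B B) ((extendScalars.{0, 0, 0} f).map h)) =
      (extendScalars.{0, 0, 0} f).map (ofHom (Linear.leftComp A (of A A) h)) ≫
        (extendScalarsHomIso f hfree hfin X).hom := by
  apply ExtendScalars.hom_ext
  intro g
  refine ExtendScalars.hom_ext (M := X) (N := of B B) fun m ↦ ?_
  exact (extendScalarsHomIso_hom_tmul_tmul f hfree hfin Y 1 1 g (h m)).trans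
    (extendScalarsHomIso_hom_tmul_tmul f hfree hfin X 1 1 (h ≫ g) m).symm

/-- Dualizing a chain complex commutes with finite free base change. -/
noncomputable def extendScalarsLinearYonedaObjIso (P : ChainComplex (ModuleCat.{0} A) ℕ) :
    ((extendScalars.{0, 0, 0} f).mapHomologicalComplex _).obj (P.linearYonedaObj A (of A A)) ≅
      ChainComplex.linearYonedaObj
        (((extendScalars.{0, 0, 0} f).mapHomologicalComplex _).obj P) B (of B B) :=
  HomologicalComplex.Hom.isoOfComponents (fun i ↦ extendScalarsHomIso f hfree hfin (P.X i))
    fun i j _ ↦ extendScalarsHomIso_naturality f hfree hfin (P.d j i)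

/-- `B ⊗ Ext^i_A(X, A) ≅ Ext^i_B(B ⊗ X, B)` when `B` is finite free over `A`. -/
noncomputable def extendScalarsExtIso (X : ModuleCat.{0} A) (i : ℕ) :
    (extendScalars.{0, 0, 0} f).obj (extMod A i X (of A A)) ≅
      extMod B i ((extendScalars.{0, 0, 0} f).obj X) (of B B) :=
  haveI : (extendScalars.{0, 0, 0} f).PreservesHomology := extendScalars_preservesHomology f <| by
    let := f.toAlgebra
    have : Module.Free A B := hfree
    exact (inferInstance : Module.Flat A B)
  let P := projectiveResolution X
  (extendScalars.{0, 0, 0} f).mapIso (P.isoExt i _) ≪≫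
    (((P.complex.linearYonedaObj A (of A A)).sc i).mapHomologyIso
      (extendScalars.{0, 0, 0} f)).symm ≪≫
    (HomologicalComplex.homologyFunctor _ _ i).mapIso
      (extendScalarsLinearYonedaObjIso f hfree hfin P.complex) ≪≫
    (((extendScalars.{0, 0, 0} f).mapProjectiveResolution P).isoExt i (of B B)).symm

end ExtBaseChange

/-- `B ⊗ Ext^i_A(M, A) ≃ Ext^i_B(N, B)` when `B` is finite free over `A` and `N ≃ B ⊗ M`. -/
lemma nonempty_tensorProduct_extMod_linearEquiv [Algebra A B] [Module.Free A B]
    [Module.Finite A B] (M N : Type) [AddCommGroup M] [Module A M] [AddCommGroup N] [Module B N]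
    (e : B ⊗[A] M ≃ₗ[B] N) (i : ℕ) :
    Nonempty (B ⊗[A] extMod A i (ModuleCat.of A M) (ModuleCat.of A A) ≃ₗ[B]
      extMod B i (ModuleCat.of B N) (ModuleCat.of B B)) := by
  obtain ⟨f, hf⟩ : ∃ f : A →+* B, ‹Algebra A B› = f.toAlgebra :=
    ⟨algebraMap A B, Algebra.algebra_ext _ _ fun _ ↦ rfl⟩
  subst hf
  let := f.toAlgebra
  have hfree : Module.Free A B := ‹_›
  let e' : (ModuleCat.extendScalars.{0, 0, 0} f).obj (ModuleCat.of A M) ≅ ModuleCat.of B N :=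
    LinearEquiv.toModuleIso (X₁ := B ⊗[A] M) e
  exact ⟨(extendScalarsExtIso f hfree ‹_› (ModuleCat.of A M) i ≪≫
    (((_root_.Ext B (ModuleCat.{0} B) i).mapIso e'.symm.op).app _)).toLinearEquiv⟩

variable [IsLocalRing A] [IsLocalRing B] [Algebra A B]

lemma ringKrullDim_eq_of_flat_of_map_maximalIdeal_eq [Module.Flat A B] [IsNoetherianRing A]
    [IsNoetherianRing B] (hmax : IsLocalRing.maximalIdeal B =
      Ideal.map (algebraMap A B) (IsLocalRing.maximalIdeal A)) :
    ringKrullDim B = ringKrullDim A := by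
  have : IsLocalHom (algebraMap A B) :=
    ((IsLocalRing.local_hom_TFAE (algebraMap A B)).out 0 2).mpr hmax.ge
  have : Nontrivial (B ⧸ IsLocalRing.maximalIdeal B) :=
    Ideal.Quotient.nontrivial_iff.mpr Ideal.IsPrime.ne_top'
  rw [← IsLocalRing.maximalIdeal_height_eq_ringKrullDim,
    ← IsLocalRing.maximalIdeal_height_eq_ringKrullDim,
    Ideal.height_eq_height_add_of_liesOver_of_hasGoingDown (IsLocalRing.maximalIdeal A)
      (IsLocalRing.maximalIdeal B), ← hmax, Ideal.map_quotient_self]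
  simp

/-- `B ⊗ k_A ≃ k_B` when `𝔪_B = 𝔪_A B`. -/
noncomputable def tensorResidueFieldEquiv (hmax : IsLocalRing.maximalIdeal B =
      Ideal.map (algebraMap A B) (IsLocalRing.maximalIdeal A)) :
    B ⊗[A] IsLocalRing.ResidueField A ≃ₗ[B] IsLocalRing.ResidueField B :=
  ((IsLocalRing.maximalIdeal A).qoutMapEquivTensorQout B).symm.trans
    (Submodule.quotEquivOfEq _ _ hmax.symm)

end BaseChange

/-- Let `(A, 𝔪, k)` be a Noetherian local ring and `A ⊆ B` a ring
extension with `B` a free `A`-module of finite rank, such that `B` is local with maximal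
ideal `𝔪·B` and `B/𝔪B` a field.  If `A` is a Gorenstein local ring, then so is `B`. -/
theorem isGorenstein_of_residue_field_extension (A : Type) [CommRing A] [IsLocalRing A]
    [IsNoetherianRing A] (B : Type) [CommRing B] [Algebra A B] [IsLocalRing B]
    (hinj : Function.Injective (algebraMap A B))
    [Module.Free A B] [Module.Finite A B]
    (hmax : IsLocalRing.maximalIdeal B =
      Ideal.map (algebraMap A B) (IsLocalRing.maximalIdeal A))
    (hfield : IsField (B ⧸ Ideal.map (algebraMap A B) (IsLocalRing.maximalIdeal A)))
    (hGorA : IsGorensteinLocal A) :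
    IsGorensteinLocal B := by
  have : IsNoetherianRing B := IsNoetherianRing.of_finite A B
  have ext_equiv := nonempty_tensorProduct_extMod_linearEquiv _ _ (tensorResidueFieldEquiv hmax)
  obtain ⟨m, -, hdim, hdepth, ⟨e⟩⟩ := hGorA
  refine ⟨m, this, (ringKrullDim_eq_of_flat_of_map_maximalIdeal_eq hmax).trans hdim, ?_, ?_⟩
  · rw [← hdepth]
    unfold ringDepth
    congr! 4 with i
    rw [← (ext_equiv i).some.toEquiv.subsingleton_congr,
      Module.FaithfullyFlat.subsingleton_tensorProduct_iff_right]
  · exact ⟨(ext_equiv m).some.symm.trans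
      ((e.baseChange A B _ _).trans (tensorResidueFieldEquiv hmax))⟩
end

section
/- For every integer n ≥ 0, dim_k T_n = dim_k R_n + Σ_{j ≥ 1} dim_k (R/I)_{n − j·d}; equivalently, the Hilbert (Poincaré) series satisfy P_T(t) = P_R(t) + (t^d / (1 − t^d)) · P_{R/I}(t). -/
noncomputable section

/-- The degree-`n` graded piece of `R[S]` where `S` is given degree `d` and `R` carries the
grading `𝒜`: a polynomial is in this piece iff its `j`-th coefficient lies in `𝒜 (n - j·d)`
(and vanishes when `j·d > n`). -/
def polyPiece (k : Type) [Field k] (R : Type) [CommRing R] [Algebra k R]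
    (𝒜 : ℕ → Submodule k R) (d n : ℕ) : Submodule k (Polynomial R) :=
  ⨅ j : ℕ, Submodule.comap ((Polynomial.lcoeff R j).restrictScalars k)
    (if j * d ≤ n then 𝒜 (n - j * d) else ⊥)

theorem sum_Icc_one {M : Type*} [AddCommMonoid M] (g : ℕ → M) (N : ℕ) :
    ∑ j ∈ Finset.Icc 1 N, g j = ∑ j ∈ Finset.range N, g (j + 1) := by
  induction N with
  | zero => simp
  | succ N ih => rw [Finset.sum_Icc_succ_top (by omega), ih, Finset.sum_range_succ]

/-- The finitely supported sequences whose `j`-th term lies in `Q j`. -/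
def finsuppPiece {k M : Type*} [Field k] [AddCommGroup M] [Module k M]
    (Q : ℕ → Submodule k M) : Submodule k (ℕ →₀ M) :=
  ⨅ j : ℕ, (Q j).comap (Finsupp.lapply j)

theorem mem_finsuppPiece {k M : Type*} [Field k] [AddCommGroup M] [Module k M]
    {Q : ℕ → Submodule k M} {a : ℕ →₀ M} : a ∈ finsuppPiece Q ↔ ∀ j, a j ∈ Q j := by
  simp [finsuppPiece]

/-- If `Q j = 0` for `j ≥ N`, then `finsuppPiece Q` is the product of the `Q j` with `j < N`. -/
def finsuppPieceEquiv {k M : Type*} [Field k] [AddCommGroup M] [Module k M]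
    (Q : ℕ → Submodule k M) (N : ℕ) (hQ : ∀ j, N ≤ j → Q j = ⊥) :
    finsuppPiece Q ≃ₗ[k] (∀ j : Fin N, Q j) :=
  LinearEquiv.ofBijective
    (LinearMap.pi fun j : Fin N =>
      LinearMap.codRestrict (Q j) ((Finsupp.lapply (j : ℕ)).comp (finsuppPiece Q).subtype)
        fun a => mem_finsuppPiece.1 a.2 j) <| by
    constructor
    · intro a b h
      ext j
      by_cases hj : j < N
      · exact congrArg Subtype.val (congrFun h ⟨j, hj⟩)
      · have ha := mem_finsuppPiece.1 a.2 j
        have hb := mem_finsuppPiece.1 b.2 j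
        rw [hQ j (not_lt.1 hj), Submodule.mem_bot] at ha hb
        rw [ha, hb]
    · intro b
      have key : ∀ j, (if h : j < N then (b ⟨j, h⟩ : M) else 0) ≠ 0 → j ∈ Finset.range N := by
        intro j hj
        by_contra h
        exact hj (dif_neg (by simpa using h))
      refine ⟨⟨Finsupp.onFinset (Finset.range N) _ key, mem_finsuppPiece.2 fun j => ?_⟩, ?_⟩
      · rw [Finsupp.onFinset_apply]
        split_ifs with h
        · exact (b ⟨j, h⟩).2
        · exact zero_mem _
      · ext j
        exact dif_pos j.2

theorem finrank_finsuppPiece {k M : Type*} [Field k] [AddCommGroup M] [Module k M]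
    (Q : ℕ → Submodule k M) [∀ j, FiniteDimensional k (Q j)] (N : ℕ)
    (hQ : ∀ j, N ≤ j → Q j = ⊥) :
    Module.finrank k (finsuppPiece Q) = ∑ j ∈ Finset.range N, Module.finrank k (Q j) := by
  rw [(finsuppPieceEquiv Q N hQ).finrank_eq, Module.finrank_pi_fintype,
    Finset.sum_range fun j => Module.finrank k (Q j)]

theorem finrank_map_add_finrank_inf_ker {k V W : Type*} [Field k] [AddCommGroup V] [Module k V]
    [AddCommGroup W] [Module k W] (g : V →ₗ[k] W) (Q : Submodule k V) [FiniteDimensional k Q] :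
    Module.finrank k (Q.map g) + Module.finrank k (Q ⊓ LinearMap.ker g : Submodule k V) =
      Module.finrank k Q := by
  have h := LinearMap.finrank_range_add_finrank_ker (g.domRestrict Q)
  rw [LinearMap.range_domRestrict] at h
  rw [← h, ← Submodule.map_comap_subtype,
    Submodule.finrank_map_subtype_eq]
  rfl

section Unprojection

open Polynomial

variable {R : Type*} [CommRing R] {I : Ideal R} (s : I →ₗ[R] R)

/-- The `R`-linear map `I[S] → R[S]` sending `a S^j` to `S^j (a S - s a)`. -/
def unprojectionMap : (ℕ →₀ I) →ₗ[R] R[X] :=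
  Finsupp.lsum R fun j => (monomial (j + 1)).comp I.subtype - (monomial j).comp s

theorem unprojectionMap_single (j : ℕ) (a : I) :
    unprojectionMap s (Finsupp.single j a) = X ^ j * (C (a : R) * X - C (s a)) := by
  simp only [unprojectionMap, Finsupp.lsum_single, LinearMap.sub_apply, LinearMap.comp_apply,
    Submodule.subtype_apply, ← C_mul_X_pow_eq_monomial]
  ring

theorem coeff_unprojectionMap_succ (a : ℕ →₀ I) (m : ℕ) :
    (unprojectionMap s a).coeff (m + 1) = a m - s (a (m + 1)) := by
  induction a using Finsupp.induction_linear with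
  | zero => simp
  | add a b ha hb =>
    simp only [map_add, coeff_add, ha, hb, Finsupp.add_apply, Submodule.coe_add]
    ring
  | single j x =>
    simp only [unprojectionMap, Finsupp.lsum_single, LinearMap.sub_apply, LinearMap.comp_apply,
      Submodule.subtype_apply, coeff_sub, coeff_monomial, Finsupp.single_apply, add_left_inj]
    split_ifs <;> simp

theorem coeff_unprojectionMap_zero (a : ℕ →₀ I) :
    (unprojectionMap s a).coeff 0 = - s (a 0) := by
  induction a using Finsupp.induction_linear with
  | zero => simp
  | add a b ha hb =>
    simp only [map_add, coeff_add, ha, hb, Finsupp.add_apply]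
    ring
  | single j x =>
    simp only [unprojectionMap, Finsupp.lsum_single, LinearMap.sub_apply, LinearMap.comp_apply,
      Submodule.subtype_apply, coeff_sub, coeff_monomial, Finsupp.single_apply]
    split_ifs <;> simp_all

/-- Terms of `a` can be recovered from the coefficients of its image, from the top down. -/
theorem forall_of_unprojectionMap (a : ℕ →₀ I) (p : ℕ → I → Prop) (h0 : ∀ j, p j 0)
    (h : ∀ j, p (j + 1) (a (j + 1)) → p j (a j)) (j : ℕ) : p j (a j) := by
  obtain ⟨N, hN⟩ : ∃ N, ∀ j, N ≤ j → a j = 0 := by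
    refine ⟨a.support.sup id + 1, fun j hj => ?_⟩
    by_contra hne
    have := Finset.le_sup (f := id) (Finsupp.mem_support_iff.2 hne)
    simp only [id] at this
    omega
  by_cases hj : N ≤ j
  · rw [hN j hj]
    exact h0 j
  · exact Nat.decreasingInduction (motive := fun j _ => p j (a j)) (fun j _ hp => h j hp)
      (by rw [hN N le_rfl]; exact h0 N) (not_le.1 hj).le

theorem unprojectionMap_injective : Function.Injective (unprojectionMap s) := by
  rw [← LinearMap.ker_eq_bot, LinearMap.ker_eq_bot']
  intro a ha
  ext j
  refine congrArg Subtype.val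
    (forall_of_unprojectionMap a (fun _ x => x = 0) (fun _ => rfl) (fun j hj => ?_) j)
  have := coeff_unprojectionMap_succ s a j
  rw [ha, hj, map_zero, coeff_zero, sub_zero] at this
  exact Subtype.ext this.symm

theorem X_mul_unprojectionMap (a : ℕ →₀ I) :
    X * unprojectionMap s a = unprojectionMap s (a.mapDomain Nat.succ) := by
  induction a using Finsupp.induction_linear with
  | zero => simp
  | add a b ha hb => rw [map_add, mul_add, ha, hb, Finsupp.mapDomain_add, map_add]
  | single j x =>
    rw [Finsupp.mapDomain_single, unprojectionMap_single, unprojectionMap_single, Nat.succ_eq_add_one]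
    ring

/-- The unprojection ideal consists of the polynomials `∑ S^j (a_j S - s a_j)`. -/
theorem mem_span_iff_mem_range_unprojectionMap {ι : Type*} (f : ι → R) (hfI : ∀ i, f i ∈ I)
    (hspan : Ideal.span (Set.range f) = I) (p : R[X]) :
    p ∈ Ideal.span {p : R[X] | ∃ i, p = C (f i) * X - C (s ⟨f i, hfI i⟩)} ↔
      p ∈ LinearMap.range (unprojectionMap s) := by
  constructor
  · intro hp
    induction hp using Submodule.span_induction with
    | mem x hx =>
      obtain ⟨i, rfl⟩ := hx
      exact ⟨Finsupp.single 0 ⟨f i, hfI i⟩, by simp [unprojectionMap_single]⟩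
    | zero => exact zero_mem _
    | add x y _ _ hx hy => exact add_mem hx hy
    | smul q x _ hx =>
      have hX : ∀ y ∈ LinearMap.range (unprojectionMap s),
          X * y ∈ LinearMap.range (unprojectionMap s) := by
        rintro _ ⟨a, rfl⟩
        exact ⟨_, (X_mul_unprojectionMap s a).symm⟩
      rw [smul_eq_mul]
      induction q using Polynomial.induction_on with
      | C r => rw [← smul_eq_C_mul]; exact Submodule.smul_mem _ r hx
      | add q q' hq hq' => rw [add_mul]; exact add_mem hq hq'
      | monomial n r h =>
        convert hX _ h using 1
        ring
  · rintro ⟨a, rfl⟩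
    induction a using Finsupp.induction_linear with
    | zero => simp
    | add a b ha hb => rw [map_add]; exact add_mem ha hb
    | single j x =>
      rw [unprojectionMap_single]
      refine Ideal.mul_mem_left _ _ ?_
      obtain ⟨x, hx⟩ := x
      have key : ∀ y, y ∈ Ideal.span (Set.range f) → ∀ hy : y ∈ I, C y * X - C (s ⟨y, hy⟩) ∈
          Ideal.span {p : R[X] | ∃ i, p = C (f i) * X - C (s ⟨f i, hfI i⟩)} := by
        intro y hy
        induction hy using Submodule.span_induction with
        | mem y hy =>
          obtain ⟨i, rfl⟩ := hy
          exact fun _ => Ideal.subset_span ⟨i, rfl⟩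
        | zero =>
          intro h
          have : s ⟨0, h⟩ = 0 := map_zero s
          simp [this]
        | add y z hy hz ihy ihz =>
          intro h
          rw [Ideal.submodule_span_eq, hspan] at hy hz
          have : s ⟨y + z, h⟩ = s ⟨y, hy⟩ + s ⟨z, hz⟩ := map_add s ⟨y, hy⟩ ⟨z, hz⟩
          convert add_mem (ihy hy) (ihz hz) using 1
          rw [this, C_add, C_add]
          ring
        | smul c y hy ihy =>
          intro h
          rw [Ideal.submodule_span_eq, hspan] at hy
          have : s ⟨c • y, h⟩ = c • s ⟨y, hy⟩ := map_smul s c ⟨y, hy⟩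
          convert Ideal.mul_mem_left _ (C c) (ihy hy) using 1
          rw [this, smul_eq_mul, smul_eq_mul, C_mul, C_mul]
          ring
      exact key x (hspan ▸ hx) hx

end Unprojection

section Graded

open Polynomial

variable {k : Type} [Field k] {R : Type} [CommRing R] [Algebra k R] (𝒜 : ℕ → Submodule k R)
  (d n : ℕ)

/-- The piece `𝒜 (n - j d)`, understood to vanish when `j d > n`. -/
def shiftedPiece (j : ℕ) : Submodule k R :=
  if j * d ≤ n then 𝒜 (n - j * d) else ⊥

instance [∀ m, FiniteDimensional k (𝒜 m)] (j : ℕ) :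
    FiniteDimensional k (shiftedPiece 𝒜 d n j) := by
  by_cases h : j * d ≤ n
  · rw [shiftedPiece, if_pos h]
    infer_instance
  · rw [shiftedPiece, if_neg h]
    infer_instance

variable {d n} in
theorem shiftedPiece_eq_bot (hd : 0 < d) {j : ℕ} (hj : n / d + 1 ≤ j) :
    shiftedPiece 𝒜 d n j = ⊥ :=
  if_neg (by rw [← Nat.le_div_iff_mul_le hd]; omega)

variable {d n} in
theorem shiftedPiece_of_le (hd : 0 < d) {j : ℕ} (hj : j ≤ n / d) :
    shiftedPiece 𝒜 d n j = 𝒜 (n - j * d) :=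
  if_pos ((Nat.le_div_iff_mul_le hd).1 hj)

theorem mem_polyPiece {p : R[X]} :
    p ∈ polyPiece k R 𝒜 d n ↔ ∀ j, p.coeff j ∈ shiftedPiece 𝒜 d n j := by
  simp [polyPiece, shiftedPiece]

/-- A polynomial is homogeneous exactly when its sequence of coefficients is. -/
def polyPieceEquiv : polyPiece k R 𝒜 d n ≃ₗ[k] finsuppPiece (shiftedPiece 𝒜 d n) where
  toFun p := ⟨p.1.toFinsupp.coeff, mem_finsuppPiece.2 ((mem_polyPiece 𝒜 d n).1 p.2)⟩
  invFun a := ⟨⟨.ofCoeff a.1⟩, (mem_polyPiece 𝒜 d n).2 (mem_finsuppPiece.1 a.2)⟩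
  left_inv _ := rfl
  right_inv _ := rfl
  map_add' _ _ := by ext; simp
  map_smul' _ _ := by ext; simp

theorem finrank_polyPiece [∀ m, FiniteDimensional k (𝒜 m)] (hd : 0 < d) :
    Module.finrank k (polyPiece k R 𝒜 d n) =
      ∑ j ∈ Finset.range (n / d + 1), Module.finrank k (𝒜 (n - j * d)) := by
  rw [(polyPieceEquiv 𝒜 d n).finrank_eq,
    finrank_finsuppPiece _ _ fun j hj => shiftedPiece_eq_bot 𝒜 hd hj]
  refine Finset.sum_congr rfl fun j hj => ?_
  rw [shiftedPiece_of_le 𝒜 hd (Finset.mem_range_succ_iff.1 hj)]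

theorem finiteDimensional_polyPiece [∀ m, FiniteDimensional k (𝒜 m)] (hd : 0 < d) :
    FiniteDimensional k (polyPiece k R 𝒜 d n) :=
  ((polyPieceEquiv 𝒜 d n).trans
    (finsuppPieceEquiv _ _ fun _ hj => shiftedPiece_eq_bot 𝒜 hd hj)).symm.finiteDimensional

variable {I : Ideal R} (s : I →ₗ[R] R)

variable {𝒜} in
theorem map_mem_shiftedPiece
    (hshom : ∀ (m : ℕ) (x : I), (x : R) ∈ 𝒜 m → s x ∈ 𝒜 (m + d)) {j : ℕ} {x : I}
    (hx : (x : R) ∈ shiftedPiece 𝒜 d n (j + 1)) : s x ∈ shiftedPiece 𝒜 d n j := by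
  unfold shiftedPiece at hx ⊢
  rw [add_mul, one_mul] at hx
  split_ifs at hx with h
  · rw [if_pos (by omega)]
    convert hshom _ x hx using 2
    omega
  · rw [Submodule.mem_bot, ZeroMemClass.coe_eq_zero] at hx
    rw [hx, map_zero]
    exact zero_mem _

variable {𝒜} in
theorem unprojectionMap_mem_polyPiece_iff
    (hshom : ∀ (m : ℕ) (x : I), (x : R) ∈ 𝒜 m → s x ∈ 𝒜 (m + d)) (a : ℕ →₀ I) :
    unprojectionMap s a ∈ polyPiece k R 𝒜 d n ↔
      ∀ j, (a j : R) ∈ shiftedPiece 𝒜 d n (j + 1) := by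
  rw [mem_polyPiece]
  constructor
  · intro h
    refine forall_of_unprojectionMap a (fun j x => (x : R) ∈ shiftedPiece 𝒜 d n (j + 1))
      (fun j => zero_mem _) fun j hj => ?_
    have := add_mem (h (j + 1)) (map_mem_shiftedPiece d n s hshom hj)
    rwa [coeff_unprojectionMap_succ, sub_add_cancel] at this
  · rintro h (_ | j)
    · rw [coeff_unprojectionMap_zero]
      exact neg_mem (map_mem_shiftedPiece d n s hshom (h 0))
    · rw [coeff_unprojectionMap_succ]
      exact sub_mem (h j) (map_mem_shiftedPiece d n s hshom (h (j + 1)))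

variable {𝒜} in
theorem finrank_polyPiece_inf_range_unprojectionMap [∀ m, FiniteDimensional k (𝒜 m)] (hd : 0 < d)
    (hshom : ∀ (m : ℕ) (x : I), (x : R) ∈ 𝒜 m → s x ∈ 𝒜 (m + d)) :
    Module.finrank k (polyPiece k R 𝒜 d n ⊓
        (LinearMap.range (unprojectionMap s)).restrictScalars k : Submodule k R[X]) =
      ∑ j ∈ Finset.Icc 1 (n / d),
        Module.finrank k (𝒜 (n - j * d) ⊓ I.restrictScalars k : Submodule k R) := by
  let ι : I →ₗ[k] R := I.subtype.restrictScalars k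
  let Q (j : ℕ) : Submodule k I := (shiftedPiece 𝒜 d n (j + 1)).comap ι
  have hι : Function.Injective ι := Subtype.val_injective
  have hQ (j : ℕ) : FiniteDimensional k (Q j) :=
    FiniteDimensional.of_injective (ι.restrict (p := Q j) (q := shiftedPiece 𝒜 d n (j + 1))
      fun _ hx => hx) fun _ _ h => Subtype.ext (hι (congrArg Subtype.val h :))
  have hmap : polyPiece k R 𝒜 d n ⊓
      (LinearMap.range (unprojectionMap s)).restrictScalars k =
      (finsuppPiece Q).map ((unprojectionMap s).restrictScalars k) := by
    ext p
    constructor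
    · rintro ⟨hp, a, rfl⟩
      exact ⟨a, mem_finsuppPiece.2
        ((unprojectionMap_mem_polyPiece_iff d n s hshom a).1 hp), rfl⟩
    · rintro ⟨a, ha, rfl⟩
      exact ⟨(unprojectionMap_mem_polyPiece_iff d n s hshom a).2 (mem_finsuppPiece.1 ha), a, rfl⟩
  rw [hmap, ← (Submodule.equivMapOfInjective ((unprojectionMap s).restrictScalars k)
    (unprojectionMap_injective s) _).finrank_eq, finrank_finsuppPiece Q (n / d) fun j hj => by
      rw [← LinearMap.ker_eq_bot.2 hι, ← Submodule.comap_bot]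
      exact congrArg (Submodule.comap ι) (shiftedPiece_eq_bot 𝒜 hd (by omega)), sum_Icc_one]
  refine Finset.sum_congr rfl fun j hj => ?_
  have hrange : LinearMap.range ι = I.restrictScalars k := by
    ext x
    exact ⟨fun ⟨y, hy⟩ => hy ▸ y.2, fun hx => ⟨⟨x, hx⟩, rfl⟩⟩
  rw [← shiftedPiece_of_le 𝒜 hd (Finset.mem_range.1 hj),
    (Submodule.equivMapOfInjective ι hι (Q j)).finrank_eq, Submodule.map_comap_eq, inf_comm,
    hrange]

end Graded

/-- Let `k` be a field, `R` a finitely generated graded `k`-algebra with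
`R₀ = k`, `I ⊆ R` a homogeneous ideal generated by homogeneous elements `f₁, …, f_r`, and
`s : I → R` an injective homogeneous `R`-module homomorphism of degree `d > 0`.  Let
`T = R[S]/(S fᵢ - s(fᵢ))` be the graded unprojection ring, graded with `deg S = d`.  Then
for every `n ≥ 0`,
`dim_k T_n = dim_k R_n + Σ_{j ≥ 1, j·d ≤ n} dim_k (R/I)_{n - j·d}`;
equivalently, the Hilbert series satisfy `P_T(t) = P_R(t) + t^d/(1 - t^d)·P_{R/I}(t)`. -/
theorem unprojection_hilbert_series (k : Type) [Field k] (R : Type) [CommRing R]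
    [Algebra k R] (𝒜 : ℕ → Submodule k R) [GradedAlgebra 𝒜]
    (hfg : Algebra.FiniteType k R)
    (h0 : ∀ x ∈ 𝒜 0, ∃ c : k, algebraMap k R c = x)
    [hfd : ∀ m, FiniteDimensional k (𝒜 m)]
    (I : Ideal R) (hIhom : Ideal.IsHomogeneous 𝒜 I)
    (d : ℕ) (hd : 0 < d)
    (s : I →ₗ[R] R) (hsinj : Function.Injective s)
    (hshom : ∀ (m : ℕ) (x : I), (x : R) ∈ 𝒜 m → s x ∈ 𝒜 (m + d))
    (r : ℕ) (f : Fin r → R) (hfI : ∀ i, f i ∈ I)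
    (hfhom : ∀ i, ∃ m, f i ∈ 𝒜 m)
    (hspan : Ideal.span (Set.range f) = I) :
    ∀ n : ℕ,
      Module.finrank k
        (Submodule.map
          (Ideal.Quotient.mkₐ k (Ideal.span {p : Polynomial R |
            ∃ i, p = Polynomial.C (f i) * Polynomial.X -
              Polynomial.C (s ⟨f i, hfI i⟩)})).toLinearMap
          (polyPiece k R 𝒜 d n)) =
      Module.finrank k (𝒜 n) +
        ∑ j ∈ Finset.Icc 1 (n / d),
          Module.finrank k
            (Submodule.map (Ideal.Quotient.mkₐ k I).toLinearMap (𝒜 (n - j * d))) := by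
  intro n
  have := finiteDimensional_polyPiece 𝒜 d n hd
  have hT := finrank_map_add_finrank_inf_ker
    (Ideal.Quotient.mkₐ k (Ideal.span {p : Polynomial R | ∃ i, p = Polynomial.C (f i) *
      Polynomial.X - Polynomial.C (s ⟨f i, hfI i⟩)})).toLinearMap (polyPiece k R 𝒜 d n)
  have hker : LinearMap.ker (Ideal.Quotient.mkₐ k (Ideal.span {p : Polynomial R | ∃ i,
      p = Polynomial.C (f i) * Polynomial.X - Polynomial.C (s ⟨f i, hfI i⟩)})).toLinearMap =
      (LinearMap.range (unprojectionMap s)).restrictScalars k := by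
    ext p
    rw [Submodule.restrictScalars_mem,
      ← mem_span_iff_mem_range_unprojectionMap s f hfI hspan p]
    exact Ideal.Quotient.eq_zero_iff_mem
  have hkerI : LinearMap.ker (Ideal.Quotient.mkₐ k I).toLinearMap = I.restrictScalars k :=
    Submodule.ext fun _ => Ideal.Quotient.eq_zero_iff_mem
  have hR (m : ℕ) := hkerI ▸
    finrank_map_add_finrank_inf_ker (Ideal.Quotient.mkₐ k I).toLinearMap (𝒜 m)
  rw [hker, finrank_polyPiece_inf_range_unprojectionMap d n s hd hshom,
    finrank_polyPiece 𝒜 d n hd, Finset.sum_range_succ', zero_mul, Nat.sub_zero,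
    ← sum_Icc_one fun j => Module.finrank k (𝒜 (n - j * d))] at hT
  have hsum : ∑ j ∈ Finset.Icc 1 (n / d), Module.finrank k (𝒜 (n - j * d)) =
      ∑ j ∈ Finset.Icc 1 (n / d),
        Module.finrank k (Submodule.map (Ideal.Quotient.mkₐ k I).toLinearMap (𝒜 (n - j * d))) +
      ∑ j ∈ Finset.Icc 1 (n / d),
        Module.finrank k (𝒜 (n - j * d) ⊓ I.restrictScalars k : Submodule k R) := by
    rw [← Finset.sum_add_distrib]
    exact Finset.sum_congr rfl fun j _ => (hR (n - j * d)).symm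
  omega
end
end

section
/- Let R be a Noetherian integrally closed (normal) domain with fraction field K, let s ∈ K with s ∉ R, and let I = { x ∈ R : x·s ∈ R } be the ideal of denominators of s, with generators f₁, …, f_k; set g_i = s·f_i ∈ R. Then the kernel of the R-algebra homomorphism R[S] → K sending S to s is exactly the ideal (S f₁ − g₁, …, S f_k − g_k); equivalently, the unprojection ring R[S]/(S f₁ − g₁, …, S f_k − g_k) is isomorphic to the subring R[s] of K generated by R and s. -/
open Polynomial in
/-- If all `C (f i) * X - C (g i)` lie in an ideal `J`, then for every `a` in the ideal generated
by the `f i` some linear polynomial `C a * X - C b` lies in `J`. -/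
theorem exists_C_mul_X_sub_C_mem_of_mem_span {R ι : Type*} [CommRing R] {f g : ι → R}
    {J : Ideal R[X]} (hJ : ∀ i, C (f i) * X - C (g i) ∈ J) {a : R}
    (ha : a ∈ Ideal.span (Set.range f)) : ∃ b : R, C a * X - C b ∈ J := by
  induction ha using Submodule.span_induction with
  | mem x hx =>
    obtain ⟨i, rfl⟩ := hx
    exact ⟨g i, hJ i⟩
  | zero => exact ⟨0, by simp⟩
  | add x y _ _ hx hy =>
    obtain ⟨b, hb⟩ := hx
    obtain ⟨c, hc⟩ := hy
    refine ⟨b + c, ?_⟩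
    convert J.add_mem hb hc using 1
    simp only [C_add]
    ring
  | smul r x _ hx =>
    obtain ⟨b, hb⟩ := hx
    refine ⟨r * b, ?_⟩
    convert J.mul_mem_left (C r) hb using 1
    simp only [smul_eq_mul, C_mul]
    ring

open Polynomial in
/-- Over an integrally closed domain, an ideal of polynomials vanishing at `s` that contains a
linear polynomial `C a * X - C b` for every denominator `a` of `s` contains every polynomial
vanishing at `s`. -/
theorem mem_of_aeval_eq_zero_of_linear_mem {R K : Type*} [CommRing R] [IsIntegrallyClosed R]
    [Field K] [Algebra R K] [IsFractionRing R K] {s : K} {J : Ideal R[X]}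
    (hJs : ∀ p ∈ J, aeval s p = 0)
    (hJ : ∀ a : R, algebraMap R K a * s ∈ (algebraMap R K).range → ∃ b : R, C a * X - C b ∈ J)
    {p : R[X]} (hp : aeval s p = 0) : p ∈ J := by
  obtain ⟨n, hn⟩ : ∃ n, p.natDegree ≤ n := ⟨_, le_rfl⟩
  induction n generalizing p with
  | zero =>
    rw [eq_C_of_natDegree_le_zero hn, aeval_C,
      map_eq_zero_iff _ (IsFractionRing.injective R K)] at hp
    rw [eq_C_of_natDegree_le_zero hn, hp, C_0]
    exact J.zero_mem
  | succ n ih =>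
    rcases hn.lt_or_eq with hlt | heq
    · exact ih hp (Nat.lt_succ_iff.mp hlt)
    have hint := isIntegral_leadingCoeff_smul p s hp
    rw [Algebra.smul_def] at hint
    obtain ⟨b, hb⟩ := hJ p.leadingCoeff (IsIntegrallyClosed.isIntegral_iff.mp hint)
    have hmem := J.mul_mem_left (X ^ n) hb
    rw [← sub_add_cancel p (X ^ n * (C p.leadingCoeff * X - C b))]
    refine J.add_mem (ih (by rw [map_sub, hp, hJs _ hmem, sub_zero]) ?_) hmem
    rw [natDegree_le_iff_coeff_eq_zero]
    intro N hN
    obtain ⟨m, rfl⟩ := Nat.exists_eq_add_of_lt hN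
    have hm : n + m + 1 = (m + 1) + n := by ring
    rw [coeff_sub, hm, coeff_X_pow_mul, coeff_sub, coeff_C_mul_X, coeff_C]
    rcases m with _ | m
    · simp [leadingCoeff, heq, add_comm]
    · have : p.coeff (m + 1 + 1 + n) = 0 := coeff_eq_zero_of_natDegree_lt (by omega)
      simp [this]

/-- Let `R` be a Noetherian normal domain with fraction field `K`, let
`s ∈ K \ R`, and let `I = {x ∈ R : x·s ∈ R}` be the ideal of denominators of `s`, with
generators `f₁, …, f_k`; set `g_i = s·f_i ∈ R`.  Then the kernel of the `R`-algebra map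
`R[S] → K`, `S ↦ s`, is exactly `(S f₁ - g₁, …, S f_k - g_k)`; equivalently, the
unprojection ring `R[S]/(S fᵢ - gᵢ)` is isomorphic to the subring `R[s] ⊆ K`. -/
theorem unprojection_eq_subring_of_fractions (R : Type) [CommRing R] [IsDomain R]
    [IsNoetherianRing R] [IsIntegrallyClosed R]
    (s : FractionRing R) (hs : s ∉ (algebraMap R (FractionRing R)).range)
    (k : ℕ) (f : Fin k → R)
    (hden : ∀ x : R,
      algebraMap R (FractionRing R) x * s ∈ (algebraMap R (FractionRing R)).range ↔
        x ∈ Ideal.span (Set.range f))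
    (g : Fin k → R)
    (hg : ∀ i, algebraMap R (FractionRing R) (g i) =
      algebraMap R (FractionRing R) (f i) * s) :
    RingHom.ker ((Polynomial.aeval s : Polynomial R →ₐ[R] FractionRing R) :
        Polynomial R →+* FractionRing R) =
      Ideal.span {p : Polynomial R |
        ∃ i, p = Polynomial.C (f i) * Polynomial.X - Polynomial.C (g i)} := by
  have hle : ∀ p ∈ Ideal.span {p : Polynomial R |
      ∃ i, p = Polynomial.C (f i) * Polynomial.X - Polynomial.C (g i)},
      Polynomial.aeval s p = 0 := by
    intro p hp
    refine (Ideal.span_le (I := RingHom.ker (Polynomial.aeval s))).mpr ?_ hp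
    rintro _ ⟨i, rfl⟩
    simp [hg]
  refine le_antisymm (fun p hp => ?_) hle
  exact mem_of_aeval_eq_zero_of_linear_mem hle (fun a ha =>
    exists_C_mul_X_sub_C_mem_of_mem_span (f := f) (g := g)
      (fun i => Ideal.subset_span (Set.mem_ofPred.mpr ⟨i, rfl⟩)) ((hden a).mp ha)) hp
end
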